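/- Busemann-type theorem for p-Rényi entropies of log-concave vectors: fix p ∈ (1,∞), set θ_p = ((log p)/(p−1)) · 1/(2(e+1)[2pe² + (4p+1)e + 1]), and let α_p be the unique positive solution α of p^{α/(p−1)} = θ_p^α + (1−θ_p)^α. Then for every random vector (X,Y) in ℝ² whose joint distribution is symmetric (invariant under z ↦ −z) and has a log-concave density, exp(α_p h_p(X+Y)) ≤ exp(α_p h_p(X)) + exp(α_p h_p(Y)). -/

import Mathlib

open MeasureTheory ProbabilityTheory Real
open scoped ENNReal

noncomputable section

/-- The real-valued random variable `X` has density `f` with respect to Lebesgue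
measure on `ℝ`. -/
def HasDensityFn1 {Ω : Type*} [MeasurableSpace Ω]
    (P : Measure Ω) (X : Ω → ℝ) (f : ℝ → ℝ) : Prop :=
  Measurable X ∧ Measurable f ∧ (∀ x, 0 ≤ f x) ∧
    Measure.map X P = volume.withDensity (fun x => ENNReal.ofReal (f x))

/-- The pair `W = (X,Y)` has joint density `w` with respect to Lebesgue measure on `ℝ²`. -/
def HasDensityFn2 {Ω : Type*} [MeasurableSpace Ω]
    (P : Measure Ω) (W : Ω → ℝ × ℝ) (w : ℝ × ℝ → ℝ) : Prop :=
  Measurable W ∧ Measurable w ∧ (∀ z, 0 ≤ w z) ∧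
    Measure.map W P = volume.withDensity (fun z => ENNReal.ofReal (w z))

/-- Rényi entropy of order `p` of a density on `ℝ`. -/
def renyiEntropy1 (p : ℝ) (f : ℝ → ℝ) : ℝ :=
  (1 / (1 - p)) * Real.log (∫ x, f x ^ p)

/-- A nonnegative function on a real vector space is log-concave:
`f(αx + (1-α)y) ≥ f(x)^α f(y)^(1-α)`. -/
def IsLogConcaveFn {E : Type*} [AddCommGroup E] [Module ℝ E] (f : E → ℝ) : Prop :=
  (∀ x, 0 ≤ f x) ∧ ∀ x y : E, ∀ α : ℝ, 0 ≤ α → α ≤ 1 →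
    f x ^ α * f y ^ (1 - α) ≤ f (α • x + (1 - α) • y)

/-- The constant `θ_p` of the Busemann-type theorem for `p`-Rényi entropies. -/
def thetaP (p : ℝ) : ℝ :=
  (Real.log p / (p - 1)) *
    (1 / (2 * (Real.exp 1 + 1) *
      (2 * p * Real.exp 1 ^ (2 : ℕ) + (4 * p + 1) * Real.exp 1 + 1)))

lemma lc_pos_convex {E : Type*} [AddCommGroup E] [Module ℝ E] {f : E → ℝ} (hf : IsLogConcaveFn f) :
    Convex ℝ {x | 0 < f x} := by
  intro x hx y hy a b ha hb hab
  have h := hf.2 x y a ha (by linarith)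
  have hb' : 1 - a = b := by linarith
  rw [hb'] at h
  have : 0 < f x ^ a * f y ^ b := mul_pos (rpow_pos_of_pos hx _) (rpow_pos_of_pos hy _)
  exact lt_of_lt_of_le this h

lemma lc_continuousOn {f : ℝ → ℝ} (hf : IsLogConcaveFn f) :
    ContinuousOn f (interior {x | 0 < f x}) := by
  have hc : ConcaveOn ℝ {x | 0 < f x} (fun x => Real.log (f x)) := by
    refine ⟨lc_pos_convex hf, ?_⟩
    intro x hx y hy a b ha hb hab
    have h := hf.2 x y a ha (by linarith)
    have hb' : 1 - a = b := by linarith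
    rw [hb'] at h
    have hx' : 0 < f x := hx
    have hy' : 0 < f y := hy
    have h2 := Real.log_le_log (mul_pos (rpow_pos_of_pos hx' _) (rpow_pos_of_pos hy' _)) h
    rw [Real.log_mul (rpow_pos_of_pos hx' _).ne' (rpow_pos_of_pos hy' _).ne',
      Real.log_rpow hx', Real.log_rpow hy'] at h2
    simpa using h2
  have h1 : ContinuousOn (fun x => Real.log (f x)) (interior {x | 0 < f x}) :=
    hc.continuousOn_interior
  have h2 : ContinuousOn (fun x => Real.exp (Real.log (f x))) (interior {x | 0 < f x}) :=
    Real.continuous_exp.comp_continuousOn h1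
  refine h2.congr ?_
  intro x hx
  have : 0 < f x := (interior_subset hx : x ∈ {x | 0 < f x})
  simp [Real.exp_log this]

lemma quantile {f : ℝ → ℝ} (hf : IsLogConcaveFn f) (hi : Integrable f) (hI : 0 < ∫ x, f x) :
    ∃ y : ℝ → ℝ, ∀ s ∈ Set.Ioo (0:ℝ) 1, 0 < f (y s) ∧ HasDerivAt y ((∫ x, f x) / f (y s)) s := by
  set I := ∫ x, f x with hIdef
  set A : ℝ → ℝ := fun x => ∫ t in Set.Iic x, f t with hA
  have hsub : ∀ a b, A b - A a = ∫ t in a..b, f t := fun a b =>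
    intervalIntegral.integral_Iic_sub_Iic hi.integrableOn hi.integrableOn
  have hAcont : Continuous A := by
    have : A = fun x => A 0 + ∫ t in (0:ℝ)..x, f t := by
      funext x; rw [← hsub]; ring
    rw [this]
    exact continuous_const.add (intervalIntegral.continuous_primitive (fun a b => hi.intervalIntegrable) 0)
  have hAmono : Monotone A := by
    intro a b hab
    have := hsub a b
    have h2 : 0 ≤ ∫ t in a..b, f t := intervalIntegral.integral_nonneg hab (fun x _ => hf.1 x)
    linarith
  have hconv := lc_pos_convex hf
  have hord := hconv.ordConnected
  -- points with A in (0,I) are interior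
  have hIntg : ∀ x, 0 < A x → A x < I → x ∈ interior {x | 0 < f x} := by
    intro x h0 h1
    have hz : ∃ z < x, 0 < f z := by
      by_contra! hcon
      have : A x = 0 := by
        simp only [hA]
        rw [integral_Iic_eq_integral_Iio]
        apply setIntegral_eq_zero_of_forall_eq_zero
        intro t ht
        exact le_antisymm (hcon t ht) (hf.1 t)
      linarith
    have hz' : ∃ z > x, 0 < f z := by
      by_contra! hcon
      have : I = A x := by
        have h := intervalIntegral.integral_Iic_add_Ioi (b := x) (hi.integrableOn) (hi.integrableOn) (μ := volume)
        have h0 : ∫ t in Set.Ioi x, f t = 0 := by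
          apply setIntegral_eq_zero_of_forall_eq_zero
          intro t ht
          exact le_antisymm (hcon t ht) (hf.1 t)
        rw [h0] at h
        simp only [hA, hIdef]
        linarith
      linarith
    obtain ⟨z, hzx, hz⟩ := hz
    obtain ⟨z', hzx', hz'⟩ := hz'
    rw [mem_interior]
    refine ⟨Set.Ioo z z', ?_, isOpen_Ioo, ⟨hzx, hzx'⟩⟩
    exact Set.Ioo_subset_Icc_self.trans (hord.out hz hz')
  have hposint : ∀ x, x ∈ interior {x | 0 < f x} → 0 < f x := fun x hx => (interior_subset hx : x ∈ {x | 0 < f x})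
  have hstrict : ∀ x x', x < x' → 0 < A x → A x' < I → A x < A x' := by
    intro x x' hlt h0 h1
    have hx := hIntg x h0 (lt_of_le_of_lt (hAmono hlt.le) h1)
    have hx' := hIntg x' (lt_of_lt_of_le h0 (hAmono hlt.le)) h1
    have := hsub x x'
    have h2 : 0 < ∫ t in x..x', f t := by
      apply intervalIntegral.intervalIntegral_pos_of_pos_on hi.intervalIntegrable _ hlt
      intro t ht
      exact hord.out (hposint x hx) (hposint x' hx') ⟨ht.1.le, ht.2.le⟩
    linarith
  have hbot : Filter.Tendsto A Filter.atBot (nhds 0) := by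
    have h : Filter.Tendsto (fun x => ∫ t in x..(0:ℝ), f t) Filter.atBot (nhds (∫ t in Set.Iic (0:ℝ), f t)) :=
      intervalIntegral_tendsto_integral_Iic 0 hi.integrableOn Filter.tendsto_id
    have h2 : A = fun x => A 0 - ∫ t in x..(0:ℝ), f t := by
      funext x; rw [← hsub]; ring
    rw [h2]
    have := h.const_sub (A 0)
    simpa [hA] using this
  have htop : Filter.Tendsto A Filter.atTop (nhds I) := by
    have h : Filter.Tendsto (fun x => ∫ t in (0:ℝ)..x, f t) Filter.atTop (nhds (∫ t in Set.Ioi (0:ℝ), f t)) :=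
      intervalIntegral_tendsto_integral_Ioi 0 hi.integrableOn Filter.tendsto_id
    have h2 : A = fun x => A 0 + ∫ t in (0:ℝ)..x, f t := by
      funext x; rw [← hsub]; ring
    have h3 : I = A 0 + ∫ t in Set.Ioi (0:ℝ), f t := by
      have h := intervalIntegral.integral_Iic_add_Ioi (b := (0:ℝ)) (hi.integrableOn) (hi.integrableOn) (μ := volume)
      simp only [hA, hIdef]; linarith
    rw [h2, h3]
    exact h.const_add (A 0)
  have hex : ∀ s ∈ Set.Ioo (0:ℝ) 1, ∃ x, A x = s * I := by
    intro s hs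
    have h0 : 0 < s * I := mul_pos hs.1 hI
    have h1 : s * I < I := by nlinarith [hs.2]
    obtain ⟨a, ha⟩ := (hbot.eventually_lt_const h0).exists
    obtain ⟨b, hb⟩ := (htop.eventually_const_lt h1).exists
    exact mem_range_of_exists_le_of_exists_ge hAcont ⟨a, ha.le⟩ ⟨b, hb.le⟩
  choose! y hy using hex
  have hAy0 : ∀ s ∈ Set.Ioo (0:ℝ) 1, 0 < A (y s) := fun s hs => by rw [hy s hs]; exact mul_pos hs.1 hI
  have hAy1 : ∀ s ∈ Set.Ioo (0:ℝ) 1, A (y s) < I := fun s hs => by rw [hy s hs]; nlinarith [hs.2]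
  refine ⟨y, fun s hs => ?_⟩
  have hys := hIntg _ (hAy0 s hs) (hAy1 s hs)
  have hpos := hposint _ hys
  refine ⟨hpos, ?_⟩
  have hmonoy : StrictMonoOn y (Set.Ioo 0 1) := by
    intro a ha b hb hab
    by_contra! hcon
    have h1 := hAmono hcon
    rw [hy a ha, hy b hb] at h1
    nlinarith
  have hcy : ContinuousAt y s := by
    apply hmonoy.continuousAt_of_image_mem_nhds (Ioo_mem_nhds hs.1 hs.2)
    have h1 : ∀ᶠ x in nhds (y s), 0 < A x := hAcont.continuousAt.eventually_const_lt (hAy0 s hs)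
    have h2 : ∀ᶠ x in nhds (y s), A x < I := hAcont.continuousAt.eventually_lt_const (hAy1 s hs)
    filter_upwards [h1, h2] with x hx1 hx2
    have hm : A x / I ∈ Set.Ioo (0:ℝ) 1 := ⟨div_pos hx1 hI, (div_lt_one hI).2 hx2⟩
    refine ⟨A x / I, hm, ?_⟩
    have h3 := hy _ hm
    rw [div_mul_cancel₀ _ hI.ne'] at h3
    rcases lt_trichotomy (y (A x / I)) x with h | h | h
    · have := hstrict _ _ h (by rw [h3]; exact hx1) hx2
      linarith
    · exact h
    · have := hstrict _ _ h hx1 (by rw [h3]; exact hx2)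
      linarith
  have hdA : HasDerivAt (fun x => A x / I) (f (y s) / I) (y s) := by
    apply HasDerivAt.div_const
    have hcf : ContinuousAt f (y s) := (lc_continuousOn hf).continuousAt (isOpen_interior.mem_nhds hys)
    have h2 : A = fun x => A 0 + ∫ t in (0:ℝ)..x, f t := by
      funext x; rw [← hsub]; ring
    rw [h2]
    apply HasDerivAt.const_add
    exact intervalIntegral.integral_hasDerivAt_right hi.intervalIntegrable
      (hi.aestronglyMeasurable.stronglyMeasurableAtFilter) hcf
  have hfin := HasDerivAt.of_local_left_inverse hcy hdA (div_pos hpos hI).ne' (by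
    filter_upwards [Ioo_mem_nhds hs.1 hs.2] with t ht
    rw [hy t ht, mul_div_cancel_right₀ _ hI.ne'])
  rwa [inv_div] at hfin

lemma cov_lower {y y' h : ℝ → ℝ} {K₀ : ℝ}
    (hy : ∀ s ∈ Set.Ioo (0:ℝ) 1, HasDerivAt y (y' s) s) (hpos : ∀ s ∈ Set.Ioo (0:ℝ) 1, 0 < y' s)
    (hK : ∀ s ∈ Set.Ioo (0:ℝ) 1, K₀ ≤ h (y s) * y' s) :
    ENNReal.ofReal K₀ ≤ ∫⁻ x in y '' Set.Ioo 0 1, ENNReal.ofReal (h x) := by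
  have hmono : StrictMonoOn y (Set.Ioo 0 1) := by
    apply strictMonoOn_of_deriv_pos (convex_Ioo 0 1)
    · intro s hs; exact (hy s hs).continuousAt.continuousWithinAt
    · intro s hs
      rw [interior_Ioo] at hs
      rw [(hy s hs).deriv]; exact hpos s hs
  rw [lintegral_image_eq_lintegral_abs_deriv_mul measurableSet_Ioo
      (fun s hs => (hy s hs).hasDerivWithinAt) hmono.injOn]
  calc ENNReal.ofReal K₀ = ∫⁻ s in Set.Ioo (0:ℝ) 1, ENNReal.ofReal K₀ := by simp
    _ ≤ _ := by
      apply setLIntegral_mono' measurableSet_Ioo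
      intro s hs
      rw [abs_of_pos (hpos s hs), ← ENNReal.ofReal_mul (hpos s hs).le]
      apply ENNReal.ofReal_le_ofReal
      rw [mul_comm]; exact hK s hs

lemma cov_lower' {y y' h : ℝ → ℝ} {K₀ : ℝ}
    (hy : ∀ s ∈ Set.Ioo (0:ℝ) 1, HasDerivAt y (y' s) s) (hpos : ∀ s ∈ Set.Ioo (0:ℝ) 1, 0 < y' s)
    (hK : ∀ s ∈ Set.Ioo (0:ℝ) 1, K₀ ≤ h (y s) * y' s) :
    ENNReal.ofReal K₀ ≤ ∫⁻ x, ENNReal.ofReal (h x) :=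
  (cov_lower hy hpos hK).trans (setLIntegral_le_lintegral _ _)

/-- 1D Prekopa-Leindler (log-concave data). -/
lemma prekopa {a b h : ℝ → ℝ} {l : ℝ} (hl0 : 0 < l) (hl1 : l < 1) (ha : IsLogConcaveFn a) (hb : IsLogConcaveFn b)
    (hai : Integrable a) (hbi : Integrable b) (hhi : Integrable h) (hh0 : ∀ x, 0 ≤ h x)
    (hh : ∀ x y, a x ^ l * b y ^ (1 - l) ≤ h (l * x + (1 - l) * y)) :
    (∫ x, a x) ^ l * (∫ x, b x) ^ (1 - l) ≤ ∫ x, h x := by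
  have hIh : 0 ≤ ∫ x, h x := integral_nonneg hh0
  have hIa : 0 ≤ ∫ x, a x := integral_nonneg ha.1
  have hIb : 0 ≤ ∫ x, b x := integral_nonneg hb.1
  rcases hIa.eq_or_lt with h0 | hIa
  · rw [← h0, zero_rpow hl0.ne', zero_mul]; exact hIh
  rcases hIb.eq_or_lt with h0 | hIb
  · rw [← h0, zero_rpow (by linarith), mul_zero]; exact hIh
  obtain ⟨y1, hy1⟩ := quantile ha hai hIa
  obtain ⟨y2, hy2⟩ := quantile hb hbi hIb
  set Ia := ∫ x, a x
  set Ib := ∫ x, b x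
  have key := cov_lower' (h := h) (K₀ := Ia ^ l * Ib ^ (1-l)) (y := fun s => l * y1 s + (1 - l) * y2 s)
    (y' := fun s => l * (Ia / a (y1 s)) + (1 - l) * (Ib / b (y2 s)))
    (fun s hs => ((hy1 s hs).2.const_mul l).add ((hy2 s hs).2.const_mul (1-l)))
    (fun s hs => by
      have := (hy1 s hs).1
      have := (hy2 s hs).1
      have : 0 < 1 - l := by linarith
      positivity)
    (fun s hs => by
      have h1 := (hy1 s hs).1
      have h2 := (hy2 s hs).1
      have h3 : 0 < 1 - l := by linarith
      have am := Real.geom_mean_le_arith_mean2_weighted hl0.le h3.le (div_pos hIa h1).le (div_pos hIb h2).le (by ring)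
      have := hh (y1 s) (y2 s)
      calc Ia ^ l * Ib ^ (1-l) = (a (y1 s) ^ l * b (y2 s) ^ (1 - l)) * ((Ia / a (y1 s)) ^ l * (Ib / b (y2 s)) ^ (1-l)) := by
            rw [Real.div_rpow hIa.le h1.le, Real.div_rpow hIb.le h2.le]
            have := (rpow_pos_of_pos h1 l).ne'
            have := (rpow_pos_of_pos h2 (1-l)).ne'
            field_simp
        _ ≤ _ := by
            apply mul_le_mul this am (by positivity) (hh0 _))
  rw [← ofReal_integral_eq_lintegral_ofReal hhi (Filter.Eventually.of_forall hh0)] at key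
  exact (ENNReal.ofReal_le_ofReal_iff hIh).1 key

lemma lc_half {f : ℝ → ℝ} (hf : IsLogConcaveFn f) :
    IsLogConcaveFn ((Set.Ioi (0:ℝ)).indicator f) := by
  refine ⟨fun x => Set.indicator_nonneg (fun x _ => hf.1 x) x, ?_⟩
  intro x y a ha0 ha1
  have hnn : ∀ z, 0 ≤ (Set.Ioi (0:ℝ)).indicator f z := fun z => Set.indicator_nonneg (fun x _ => hf.1 x) z
  rcases ha0.eq_or_lt with h | ha0
  · subst h; simp
  rcases ha1.eq_or_lt with h | ha1
  · subst h; simp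
  by_cases hx : 0 < x
  · by_cases hy : 0 < y
    · have : 0 < a • x + (1 - a) • y := by
        simp only [smul_eq_mul]
        have : 0 < 1 - a := by linarith
        positivity
      rw [Set.indicator_of_mem (Set.mem_Ioi.2 hx), Set.indicator_of_mem (Set.mem_Ioi.2 hy), Set.indicator_of_mem (Set.mem_Ioi.2 this)]
      exact hf.2 x y a ha0.le ha1.le
    · rw [Set.indicator_of_notMem (s := Set.Ioi (0:ℝ)) (a := y) (by simpa using hy), zero_rpow (by linarith), mul_zero]
      exact hnn _
  · rw [Set.indicator_of_notMem (s := Set.Ioi (0:ℝ)) (a := x) (by simpa using hx), zero_rpow (by linarith), zero_mul]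
    exact hnn _

lemma lc_line {w : ℝ × ℝ → ℝ} (hw : IsLogConcaveFn w) (z e : ℝ × ℝ) : IsLogConcaveFn (fun s : ℝ => w (z + s • e)) := by
  refine ⟨fun _ => hw.1 _, ?_⟩
  intro x y a h0 h1
  have := hw.2 (z + x • e) (z + y • e) a h0 h1
  convert this using 2
  ext <;> simp <;> ring

lemma lc_line0 {w : ℝ × ℝ → ℝ} (hw : IsLogConcaveFn w) (e : ℝ × ℝ) : IsLogConcaveFn (fun s : ℝ => w (s • e)) := by
  simpa using lc_line hw 0 e

lemma even_half {f : ℝ → ℝ} (he : ∀ x, f (-x) = f x) (hi : Integrable f) :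
    ∫ x in Set.Ioi (0:ℝ), f x = (∫ x, f x) / 2 := by
  have h := intervalIntegral.integral_Iic_add_Ioi (b := (0:ℝ)) (hi.integrableOn) (hi.integrableOn) (μ := volume)
  have h2 : ∫ x in Set.Iic (0:ℝ), f x = ∫ x in Set.Ioi (0:ℝ), f x := by
    have := integral_comp_neg_Ioi (0:ℝ) f
    simp only [he, neg_zero] at this
    exact this.symm
  linarith

lemma gm_hm {l A B : ℝ} (h0 : 0 < l) (h1 : l < 1) (hA : 0 < A) (hB : 0 < B) :
    1 / (1 / A + 1 / B) ≤ (l * A) ^ l * ((1 - l) * B) ^ (1 - l) := by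
  have h3 : 0 < 1 - l := by linarith
  have am := Real.geom_mean_le_arith_mean2_weighted h0.le h3.le (p₁ := 1 / (l * A)) (p₂ := 1 / ((1 - l) * B))
    (by positivity) (by positivity) (by ring)
  have e1 : l * (1 / (l * A)) + (1 - l) * (1 / ((1 - l) * B)) = 1 / A + 1 / B := by
    field_simp
  rw [e1, Real.div_rpow (by norm_num) (by positivity), Real.div_rpow (by norm_num) (by positivity), one_rpow, one_rpow] at am
  have p1 : 0 < (l * A) ^ l := rpow_pos_of_pos (by positivity) _
  have p2 : 0 < ((1 - l) * B) ^ (1 - l) := rpow_pos_of_pos (by positivity) _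
  rw [div_le_iff₀ (by positivity)]
  have := mul_le_mul_of_nonneg_left am (mul_pos p1 p2).le
  refine le_trans (le_of_eq ?_) this
  field_simp

lemma busemann_dir {w : ℝ × ℝ → ℝ} (hw : IsLogConcaveFn w) (he : ∀ z, w (-z) = w z) (e1 e2 : ℝ × ℝ)
    (hi1 : Integrable (fun s : ℝ => w (s • e1))) (hi2 : Integrable (fun s : ℝ => w (s • e2)))
    (hi : Integrable (fun s : ℝ => w (s • (e1 + e2))))
    (hp1 : 0 < ∫ s : ℝ, w (s • e1)) (hp2 : 0 < ∫ s : ℝ, w (s • e2)) :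
    1 / (∫ s : ℝ, w (s • (e1 + e2))) ≤ 1 / (∫ s : ℝ, w (s • e1)) + 1 / (∫ s : ℝ, w (s • e2)) := by
  have hev : ∀ e : ℝ × ℝ, ∀ s : ℝ, w ((-s) • e) = w (s • e) := by
    intro e s; rw [neg_smul, he]
  set a : ℝ → ℝ := (Set.Ioi (0:ℝ)).indicator (fun s : ℝ => w (s • e1)) with ha
  set b : ℝ → ℝ := (Set.Ioi (0:ℝ)).indicator (fun s : ℝ => w (s • e2)) with hb
  set h : ℝ → ℝ := (Set.Ioi (0:ℝ)).indicator (fun s : ℝ => w (s • (e1 + e2))) with hh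
  have hla : IsLogConcaveFn a := lc_half (lc_line0 hw e1)
  have hlb : IsLogConcaveFn b := lc_half (lc_line0 hw e2)
  have hIa : ∫ s, a s = (∫ s : ℝ, w (s • e1)) / 2 := by
    rw [ha, integral_indicator measurableSet_Ioi, even_half (hev e1) hi1]
  have hIb : ∫ s, b s = (∫ s : ℝ, w (s • e2)) / 2 := by
    rw [hb, integral_indicator measurableSet_Ioi, even_half (hev e2) hi2]
  have hIh : ∫ s, h s = (∫ s : ℝ, w (s • (e1 + e2))) / 2 := by
    rw [hh, integral_indicator measurableSet_Ioi, even_half (hev _) hi]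
  have hai : Integrable a := hi1.indicator measurableSet_Ioi
  have hbi : Integrable b := hi2.indicator measurableSet_Ioi
  have hhi : Integrable h := hi.indicator measurableSet_Ioi
  have hh0 : ∀ x, 0 ≤ h x := fun z => Set.indicator_nonneg (fun x _ => hw.1 _) z
  have hpa : 0 < ∫ s, a s := by rw [hIa]; linarith
  have hpb : 0 < ∫ s, b s := by rw [hIb]; linarith
  obtain ⟨y1, hy1⟩ := quantile hla hai hpa
  obtain ⟨y2, hy2⟩ := quantile hlb hbi hpb
  have haux : 1 / (1 / (∫ s, a s) + 1 / (∫ s, b s)) ≤ ∫ s, h s := by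
    set Ia := ∫ s, a s
    set Ib := ∫ s, b s
    have pos1 : ∀ s ∈ Set.Ioo (0:ℝ) 1, 0 < y1 s := by
      intro s hs
      by_contra hcon
      have := (hy1 s hs).1
      rw [ha, Set.indicator_of_notMem (by simpa using hcon)] at this
      exact lt_irrefl _ this
    have pos2 : ∀ s ∈ Set.Ioo (0:ℝ) 1, 0 < y2 s := by
      intro s hs
      by_contra hcon
      have := (hy2 s hs).1
      rw [hb, Set.indicator_of_notMem (by simpa using hcon)] at this
      exact lt_irrefl _ this
    have key := cov_lower' (h := h) (K₀ := 1 / (1 / Ia + 1 / Ib)) (y := fun s => (y1 s * y2 s) / (y1 s + y2 s))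
      (y' := fun s => (y2 s / (y1 s + y2 s)) ^ 2 * (Ia / a (y1 s)) + (y1 s / (y1 s + y2 s)) ^ 2 * (Ib / b (y2 s)))
      (fun s hs => by
        have q1 := pos1 s hs
        have q2 := pos2 s hs
        have d := ((hy1 s hs).2.mul (hy2 s hs).2).div ((hy1 s hs).2.add (hy2 s hs).2) (by simp only [Pi.add_apply]; positivity)
        have e : ((Ia / a (y1 s) * y2 s + y1 s * (Ib / b (y2 s))) * (y1 + y2) s - (y1 * y2) s * (Ia / a (y1 s) + Ib / b (y2 s))) /
            (y1 + y2) s ^ 2 = (y2 s / (y1 s + y2 s)) ^ 2 * (Ia / a (y1 s)) + (y1 s / (y1 s + y2 s)) ^ 2 * (Ib / b (y2 s)) := by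
          simp only [Pi.add_apply, Pi.mul_apply]
          field_simp
          ring
        rw [e] at d
        exact d)
      (fun s hs => by
        have := (hy1 s hs).1
        have := (hy2 s hs).1
        have q1 := pos1 s hs
        have q2 := pos2 s hs
        positivity)
      (fun s hs => by
        have h1 := (hy1 s hs).1
        have h2 := (hy2 s hs).1
        have q1 := pos1 s hs
        have q2 := pos2 s hs
        obtain ⟨l, hl⟩ : ∃ l, l = y2 s / (y1 s + y2 s) := ⟨_, rfl⟩
        have hl' : y1 s / (y1 s + y2 s) = 1 - l := by rw [hl]; field_simp; ring
        have hl0 : 0 < l := by rw [hl]; positivity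
        have h3 : 0 < 1 - l := by rw [← hl']; positivity
        rw [hl', ← hl]
        have am := Real.geom_mean_le_arith_mean2_weighted hl0.le h3.le (p₁ := l * (Ia / a (y1 s))) (p₂ := (1 - l) * (Ib / b (y2 s)))
          (by positivity) (by positivity) (by ring)
        have hge : a (y1 s) ^ l * b (y2 s) ^ (1 - l) ≤ h (y1 s * y2 s / (y1 s + y2 s)) := by
          have := hw.2 (y1 s • e1) (y2 s • e2) l hl0.le (by linarith)
          rw [ha, hb, hh, Set.indicator_of_mem (Set.mem_Ioi.2 q1), Set.indicator_of_mem (Set.mem_Ioi.2 q2),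
            Set.indicator_of_mem (Set.mem_Ioi.2 (by positivity))]
          convert this using 2
          rw [smul_smul, smul_smul, smul_add, ← hl', hl]
          congr 2 <;> field_simp
        calc 1 / (1 / Ia + 1 / Ib) ≤ (l * Ia) ^ l * ((1 - l) * Ib) ^ (1 - l) := gm_hm hl0 (by linarith) hpa hpb
          _ = (a (y1 s) ^ l * b (y2 s) ^ (1 - l)) * ((l * (Ia / a (y1 s))) ^ l * ((1 - l) * (Ib / b (y2 s))) ^ (1-l)) := by
            rw [← mul_div_assoc, ← mul_div_assoc, Real.div_rpow (by positivity) h1.le, Real.div_rpow (by positivity) h2.le]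
            have := (rpow_pos_of_pos h1 l).ne'
            have := (rpow_pos_of_pos h2 (1-l)).ne'
            field_simp
          _ ≤ _ := by
            refine mul_le_mul hge (am.trans (le_of_eq (by ring))) (by positivity) (hh0 _))
    rw [← ofReal_integral_eq_lintegral_ofReal hhi (Filter.Eventually.of_forall hh0)] at key
    exact (ENNReal.ofReal_le_ofReal_iff (integral_nonneg hh0)).1 key
  rw [hIa, hIb, hIh] at haux
  set A := ∫ s : ℝ, w (s • e1)
  set B := ∫ s : ℝ, w (s • e2)
  set H := ∫ s : ℝ, w (s • (e1 + e2))
  have h1 : 1 / (1 / A + 1 / B) ≤ H := by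
    have : 1 / (1 / (A/2) + 1 / (B/2)) = (1 / (1 / A + 1 / B)) / 2 := by field_simp
    linarith
  have h2 : 0 < 1 / (1 / A + 1 / B) := by positivity
  have h3 := one_div_le_one_div_of_le h2 h1
  rwa [one_div_one_div] at h3

structure GoodW (w : ℝ × ℝ → ℝ) : Prop where
  meas : Measurable w
  lc : IsLogConcaveFn w
  even : ∀ z, w (-z) = w z
  int : Integrable w
  one : ∫ z, w z = 1

def shearW (c : ℝ) (w : ℝ × ℝ → ℝ) : ℝ × ℝ → ℝ := fun z => w (z.1 + c * z.2, z.2)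
def swapW (w : ℝ × ℝ → ℝ) : ℝ × ℝ → ℝ := fun z => w (z.2, z.1)
def mgW (w : ℝ × ℝ → ℝ) (x : ℝ) : ℝ := ∫ y, w (x, y)

lemma lc_mid {E : Type*} [AddCommGroup E] [Module ℝ E] {f : E → ℝ} (hf : IsLogConcaveFn f) (x y z : E)
    (h : z = (1/2:ℝ) • x + (1/2:ℝ) • y) : √(f x) * √(f y) ≤ f z := by
  have := hf.2 x y (1/2) (by norm_num) (by norm_num)
  rw [Real.sqrt_eq_rpow, Real.sqrt_eq_rpow, h]
  norm_num at this ⊢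
  exact this

lemma measurePreserving_swapR : MeasurePreserving (fun z : ℝ × ℝ => (z.2, z.1)) :=
  Measure.measurePreserving_swap

lemma GoodW.swap {w : ℝ × ℝ → ℝ} (h : GoodW w) : GoodW (swapW w) := by
  have mp := measurePreserving_swapR
  have me : MeasurableEmbedding (fun z : ℝ × ℝ => (z.2, z.1)) :=
    (MeasurableEquiv.prodComm (α := ℝ) (β := ℝ)).measurableEmbedding
  refine ⟨?_, ⟨fun z => h.lc.1 _, ?_⟩, ?_, ?_, ?_⟩
  · exact h.meas.comp mp.measurable
  · intro x y a h0 h1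
    exact h.lc.2 (x.2, x.1) (y.2, y.1) a h0 h1
  · intro z; exact h.even (z.2, z.1)
  · exact (mp.integrable_comp_emb me).2 h.int
  · rw [← h.one]; exact mp.integral_comp me w

lemma measurePreserving_shear (c : ℝ) : MeasurePreserving (fun z : ℝ × ℝ => (z.1 + c * z.2, z.2)) := by
  have h : MeasurePreserving (fun z : ℝ × ℝ => (z.1, z.2 + c * z.1)) := by
    refine (MeasurePreserving.id (volume : Measure ℝ)).skew_product (g := fun x y => y + c * x) (by fun_prop) ?_
    filter_upwards with x
    exact (measurePreserving_add_right volume (c * x)).map_eq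
  exact measurePreserving_swapR.comp (h.comp measurePreserving_swapR)

def shearEquiv (c : ℝ) : (ℝ × ℝ) ≃ᵐ (ℝ × ℝ) where
  toFun z := (z.1 + c * z.2, z.2)
  invFun z := (z.1 - c * z.2, z.2)
  left_inv z := by ext <;> simp
  right_inv z := by ext <;> simp
  measurable_toFun := by simp only [Equiv.coe_fn_mk]; fun_prop
  measurable_invFun := by simp only [Equiv.coe_fn_symm_mk]; fun_prop

lemma GoodW.shear {w : ℝ × ℝ → ℝ} (h : GoodW w) (c : ℝ) : GoodW (shearW c w) := by
  have mp := measurePreserving_shear c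
  have me : MeasurableEmbedding (fun z : ℝ × ℝ => (z.1 + c * z.2, z.2)) :=
    (shearEquiv c).measurableEmbedding
  refine ⟨?_, ⟨fun z => h.lc.1 _, ?_⟩, ?_, ?_, ?_⟩
  · exact h.meas.comp mp.measurable
  · intro x y a h0 h1
    have := h.lc.2 (x.1 + c * x.2, x.2) (y.1 + c * y.2, y.2) a h0 h1
    refine this.trans (le_of_eq ?_)
    simp only [shearW]
    congr 1
    ext <;> simp
    ring
  · intro z
    have := h.even (z.1 + c * z.2, z.2)
    rw [shearW, shearW, ← this]
    congr 1
    ext <;> simp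
    ring
  · exact (mp.integrable_comp_emb me).2 h.int
  · rw [← h.one]; exact mp.integral_comp me w

lemma GoodW.le_zero {w : ℝ × ℝ → ℝ} (h : GoodW w) (z : ℝ × ℝ) : w z ≤ w 0 := by
  have := lc_mid h.lc z (-z) 0 (by simp)
  rwa [h.even, Real.mul_self_sqrt (h.lc.1 z)] at this

lemma GoodW.zero_pos {w : ℝ × ℝ → ℝ} (h : GoodW w) : 0 < w 0 := by
  by_contra hcon
  have h0 : w = 0 := by
    funext z
    exact le_antisymm ((h.le_zero z).trans (not_lt.1 hcon)) (h.lc.1 z)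
  have := h.one
  rw [h0] at this
  simp at this

lemma GoodW.interior_mem {w : ℝ × ℝ → ℝ} (h : GoodW w) : (0 : ℝ × ℝ) ∈ interior {z | 0 < w z} := by
  have hc := lc_pos_convex h.lc
  have hpos : 0 < volume {z | 0 < w z} := by
    have h1 : 0 < ∫ z, w z := by rw [h.one]; norm_num
    rw [integral_pos_iff_support_of_nonneg h.lc.1 h.int] at h1
    refine h1.trans_le (measure_mono ?_)
    intro z hz
    exact lt_of_le_of_ne (h.lc.1 z) (Ne.symm hz)
  have hne : (interior {z | 0 < w z}).Nonempty := by
    by_contra hcon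
    rw [Set.not_nonempty_iff_eq_empty] at hcon
    have hfr := hc.addHaar_frontier (volume : Measure (ℝ × ℝ))
    rw [frontier, hcon, Set.sdiff_empty] at hfr
    have := measure_mono_null subset_closure hfr
    rw [this] at hpos
    exact lt_irrefl _ hpos
  obtain ⟨z, hz⟩ := hne
  have hz' : -z ∈ interior {z | 0 < w z} := by
    have e : {z | 0 < w z} = (Homeomorph.neg (ℝ × ℝ)) ⁻¹' {z | 0 < w z} := by
      ext x; simp [h.even]
    rw [e, ← Homeomorph.preimage_interior]
    simpa using hz
  have := hc.interior hz hz' (a := 1/2) (b := 1/2) (by norm_num) (by norm_num) (by norm_num)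
  simpa using this

lemma GoodW.line_meas {w : ℝ × ℝ → ℝ} (h : GoodW w) (z e : ℝ × ℝ) : Measurable (fun s : ℝ => w (z + s • e)) := by
  apply h.meas.comp
  fun_prop

lemma pos_integral_of_nhds {f : ℝ → ℝ} (hf : Measurable f) (hn : ∀ᶠ x in nhds (0:ℝ), 0 < f x) :
    (∫⁻ x, ENNReal.ofReal (f x)) ≠ 0 := by
  intro hcon
  obtain ⟨ε, hε, hb⟩ := Metric.eventually_nhds_iff_ball.1 hn
  rw [lintegral_eq_zero_iff (by fun_prop)] at hcon
  have h1 : volume (Metric.ball (0:ℝ) ε) = 0 := by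
    refine measure_mono_null ?_ hcon
    intro x hx
    have := hb x hx
    simp [this]
  exact (Metric.measure_ball_pos volume (0:ℝ) hε).ne' h1

lemma GoodW.line_ev {w : ℝ × ℝ → ℝ} (h : GoodW w) (e : ℝ × ℝ) : ∀ᶠ s in nhds (0:ℝ), 0 < w (s • e) := by
  have hc : Filter.Tendsto (fun s : ℝ => s • e) (nhds 0) (nhds 0) := by
    have : Continuous (fun s : ℝ => s • e) := by fun_prop
    simpa using this.tendsto 0
  exact hc.eventually (mem_interior_iff_mem_nhds.1 h.interior_mem)


lemma GoodW.axis_int {w : ℝ × ℝ → ℝ} (h : GoodW w) : Integrable (fun y : ℝ => w (0, y)) := by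
  have hm1 : Measurable (fun x : ℝ => √(w (2 * x, 0))) := by
    have := h.meas; fun_prop
  have hm2 : Measurable (fun y : ℝ => √(w (0, 2 * y))) := by
    have := h.meas; fun_prop
  set Pp := ∫⁻ x : ℝ, ENNReal.ofReal (√(w (2 * x, 0))) with hP
  set Q := ∫⁻ y : ℝ, ENNReal.ofReal (√(w (0, 2 * y))) with hQ
  have hPQ : Pp * Q ≤ 1 := by
    have h1 : ∫⁻ z, ENNReal.ofReal (w z) = 1 := by
      rw [← ofReal_integral_eq_lintegral_ofReal h.int (Filter.Eventually.of_forall h.lc.1), h.one, ENNReal.ofReal_one]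
    rw [← h1, Measure.volume_eq_prod, lintegral_prod _ (by have := h.meas; fun_prop), hP, hQ, ← lintegral_mul_const _ (by fun_prop)]
    apply lintegral_mono
    intro x
    dsimp only
    rw [← lintegral_const_mul _ (by fun_prop)]
    apply lintegral_mono
    intro y
    dsimp only
    rw [← ENNReal.ofReal_mul (by positivity)]
    apply ENNReal.ofReal_le_ofReal
    apply lc_mid h.lc
    ext <;> simp
  have hP0 : Pp ≠ 0 := by
    apply pos_integral_of_nhds hm1
    filter_upwards [h.line_ev (2, 0)] with x hx
    apply Real.sqrt_pos.2
    convert hx using 2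
    ext <;> simp [mul_comm]
  have hQ1 : Q < ⊤ := by
    by_contra hcon
    rw [not_lt, top_le_iff] at hcon
    rw [hcon, ENNReal.mul_top hP0] at hPQ
    simp at hPQ
  have hi : Integrable (fun y : ℝ => w (0, 2 * y)) := by
    refine ⟨Measurable.aestronglyMeasurable (by have := h.meas; fun_prop), ?_⟩
    rw [hasFiniteIntegral_iff_ofReal (Filter.Eventually.of_forall fun y => h.lc.1 _)]
    calc ∫⁻ y : ℝ, ENNReal.ofReal (w (0, 2 * y)) ≤ ∫⁻ y : ℝ, ENNReal.ofReal (√(w 0)) * ENNReal.ofReal (√(w (0, 2 * y))) := by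
          apply lintegral_mono
          intro y
          dsimp only
          rw [← ENNReal.ofReal_mul (by positivity)]
          apply ENNReal.ofReal_le_ofReal
          calc w (0, 2 * y) = √(w (0, 2 * y)) * √(w (0, 2 * y)) := (Real.mul_self_sqrt (h.lc.1 _)).symm
            _ ≤ _ := by
              gcongr
              exact h.le_zero _
      _ = ENNReal.ofReal (√(w 0)) * Q := by rw [lintegral_const_mul _ (by fun_prop)]
      _ < ⊤ := ENNReal.mul_lt_top ENNReal.ofReal_lt_top hQ1
  exact (integrable_comp_mul_left_iff (fun y => w (0, y)) (two_ne_zero)).1 hi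

lemma GoodW.slice_int {w : ℝ × ℝ → ℝ} (h : GoodW w) (x : ℝ) : Integrable (fun y : ℝ => w (x, y)) := by
  by_cases hz : ∃ y0, 0 < w (x, y0)
  · obtain ⟨y0, hy0⟩ := hz
    have hi : Integrable (fun y : ℝ => w (0, (y - y0) / 2)) := by
      have h1 : Integrable (fun y : ℝ => w (0, y / 2)) := by
        have := (integrable_comp_mul_left_iff (fun y => w (0, y)) (inv_ne_zero (two_ne_zero (α := ℝ)))).2 h.axis_int
        refine this.congr (Filter.Eventually.of_forall fun y => ?_)
        simp only; congr 2; ring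
      exact h1.comp_sub_right y0
    refine (hi.const_mul (√(w 0) / √(w (x, y0)))).mono' (Measurable.aestronglyMeasurable (by have := h.meas; fun_prop)) (Filter.Eventually.of_forall fun y => ?_)
    rw [Real.norm_of_nonneg (h.lc.1 _)]
    have h1 := lc_mid h.lc (x, y) (-(x, y0)) (0, (y - y0) / 2) (by ext <;> simp; ring)
    rw [h.even] at h1
    have hs : 0 < √(w (x, y0)) := Real.sqrt_pos.2 hy0
    rw [div_mul_eq_mul_div, le_div_iff₀ hs]
    calc w (x, y) * √(w (x, y0)) = √(w (x, y)) * (√(w (x, y)) * √(w (x, y0))) := by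
          rw [← mul_assoc, Real.mul_self_sqrt (h.lc.1 _)]
      _ ≤ _ := by
        gcongr
        exact h.le_zero _
  · push Not at hz
    have : (fun y : ℝ => w (x, y)) = fun _ => 0 := by
      funext y; exact le_antisymm (hz y) (h.lc.1 _)
    rw [this]; exact integrable_zero _ _ _

structure GoodF (F : ℝ → ℝ) : Prop where
  meas : Measurable F
  lc : IsLogConcaveFn F
  even : ∀ z, F (-z) = F z
  int : Integrable F
  one : ∫ z, F z = 1

lemma GoodW.mg {w : ℝ × ℝ → ℝ} (h : GoodW w) : GoodF (mgW w) := by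
  have hnn : ∀ x, 0 ≤ mgW w x := fun x => integral_nonneg fun y => h.lc.1 _
  have hi : Integrable w (volume.prod volume) := by rw [← Measure.volume_eq_prod]; exact h.int
  refine ⟨?_, ⟨hnn, ?_⟩, ?_, ?_, ?_⟩
  · exact (h.meas.stronglyMeasurable.integral_prod_right').measurable
  · intro x y a h0 h1
    rcases h0.eq_or_lt with hh | h0
    · subst hh; simp
    rcases h1.eq_or_lt with hh | h1
    · subst hh; simp
    refine prekopa h0 h1 ?_ ?_ (h.slice_int _) (h.slice_int _) (h.slice_int _) (fun y => h.lc.1 _) ?_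
    · simpa using lc_line h.lc (x, 0) (0, 1)
    · simpa using lc_line h.lc (y, 0) (0, 1)
    · intro s t
      exact h.lc.2 (x, s) (y, t) a h0.le h1.le
  · intro x
    simp only [mgW]
    rw [← integral_neg_eq_self]
    congr 1
    funext y
    exact h.even (x, y)
  · exact hi.integral_prod_left
  · rw [← h.one, Measure.volume_eq_prod, integral_prod _ hi]; rfl

lemma GoodF.le_zero {F : ℝ → ℝ} (h : GoodF F) (z : ℝ) : F z ≤ F 0 := by
  have := lc_mid h.lc z (-z) 0 (by simp)
  rwa [h.even, Real.mul_self_sqrt (h.lc.1 z)] at this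

lemma GoodF.zero_pos {F : ℝ → ℝ} (h : GoodF F) : 0 < F 0 := by
  by_contra hcon
  have h0 : F = 0 := by
    funext z
    exact le_antisymm ((h.le_zero z).trans (not_lt.1 hcon)) (h.lc.1 z)
  have := h.one
  rw [h0] at this
  simp at this

lemma GoodF.anti {F : ℝ → ℝ} (h : GoodF F) {x y : ℝ} (hx : 0 ≤ x) (hxy : x ≤ y) : F y ≤ F x := by
  rcases hx.eq_or_lt with hh | hx
  · subst hh; exact h.le_zero y
  have hy : 0 < y := by linarith
  have := h.lc.2 y (-y) ((x + y) / (2 * y)) (by positivity) (by rw [div_le_one (by positivity)]; linarith)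
  rw [h.even] at this
  rcases (h.lc.1 y).eq_or_lt with h0 | h0
  · rw [← h0]; exact h.lc.1 x
  rw [← rpow_add h0, add_sub_cancel, rpow_one] at this
  refine this.trans (le_of_eq ?_)
  congr 1
  simp only [smul_eq_mul]
  field_simp
  ring

lemma GoodF.scale {F : ℝ → ℝ} (h : GoodF F) {p : ℝ} (hp : 1 ≤ p) (x : ℝ) :
    F x * F 0 ^ (p - 1) ≤ F (x / p) ^ p := by
  have hp0 : 0 < p := by linarith
  have := h.lc.2 x 0 (1/p) (by positivity) (by rw [div_le_one hp0]; exact hp)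
  have h1 := Real.rpow_le_rpow (by have := h.lc.1 x; have := h.lc.1 0; positivity) this hp0.le
  rw [mul_rpow (rpow_nonneg (h.lc.1 _) _) (rpow_nonneg (h.lc.1 _) _), ← rpow_mul (h.lc.1 _), ← rpow_mul (h.lc.1 _)] at h1
  have e1 : 1 / p * p = 1 := by field_simp
  have e2 : (1 - 1 / p) * p = p - 1 := by field_simp
  rw [e1, e2, rpow_one] at h1
  refine h1.trans (le_of_eq ?_)
  congr 2
  simp
  ring

lemma GoodF.pow_le {F : ℝ → ℝ} (h : GoodF F) {p : ℝ} (hp : 1 ≤ p) (x : ℝ) : F x ^ p ≤ F 0 ^ (p - 1) * F x := by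
  have h1 : F x ^ p = F x ^ (p - 1) * F x := by
    rcases (h.lc.1 x).eq_or_lt with h0 | h0
    · rw [← h0, zero_rpow (by linarith), mul_zero]
    · rw [← rpow_add_one h0.ne', sub_add_cancel]
  rw [h1]
  apply mul_le_mul_of_nonneg_right _ (h.lc.1 x)
  exact Real.rpow_le_rpow (h.lc.1 x) (h.le_zero x) (by linarith)

lemma GoodF.pow_int {F : ℝ → ℝ} (h : GoodF F) {p : ℝ} (hp : 1 ≤ p) : Integrable (fun x => F x ^ p) := by
  refine (h.int.const_mul (F 0 ^ (p-1))).mono' (Measurable.aestronglyMeasurable (by have := h.meas; fun_prop)) (Filter.Eventually.of_forall fun x => ?_)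
  rw [Real.norm_of_nonneg (rpow_nonneg (h.lc.1 _) _)]
  exact h.pow_le hp x

lemma GoodF.int_pow_le {F : ℝ → ℝ} (h : GoodF F) {p : ℝ} (hp : 1 ≤ p) : ∫ x, F x ^ p ≤ F 0 ^ (p - 1) := by
  calc ∫ x, F x ^ p ≤ ∫ x, F 0 ^ (p-1) * F x := integral_mono (h.pow_int hp) (h.int.const_mul _) (h.pow_le hp)
    _ = _ := by rw [integral_const_mul, h.one, mul_one]

lemma GoodF.le_int_pow {F : ℝ → ℝ} (h : GoodF F) {p : ℝ} (hp : 1 ≤ p) : F 0 ^ (p - 1) ≤ p * ∫ x, F x ^ p := by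
  have hp0 : 0 < p := by linarith
  have hi : Integrable (fun x => F (x / p) ^ p) := by
    have := (integrable_comp_mul_left_iff (fun x => F x ^ p) (inv_ne_zero hp0.ne')).2 (h.pow_int hp)
    refine this.congr (Filter.Eventually.of_forall fun y => ?_)
    simp only; congr 2; ring
  calc F 0 ^ (p-1) = ∫ x, F x * F 0 ^ (p-1) := by rw [integral_mul_const, h.one, one_mul]
    _ ≤ ∫ x, F (x / p) ^ p := integral_mono (h.int.mul_const _) hi (fun x => h.scale hp x)
    _ = _ := by
      rw [Measure.integral_comp_div (fun x => F x ^ p) p, abs_of_pos hp0, smul_eq_mul]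

lemma GoodF.sqrt_le {F : ℝ → ℝ} (h : GoodF F) (x : ℝ) : √(F x) * √(F 0) ≤ F (x / 2) := by
  apply lc_mid h.lc
  simp; ring

lemma GoodF.comp_half_int {F : ℝ → ℝ} (h : GoodF F) : Integrable (fun x => F (x / 2)) := by
  have := (integrable_comp_mul_left_iff F (inv_ne_zero (two_ne_zero (α := ℝ)))).2 h.int
  refine this.congr (Filter.Eventually.of_forall fun y => ?_)
  simp only; congr 1; ring

lemma GoodF.sqrt_int {F : ℝ → ℝ} (h : GoodF F) : Integrable (fun x => √(F x)) := by
  have h0 := Real.sqrt_pos.2 h.zero_pos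
  refine (h.comp_half_int.const_mul (√(F 0))⁻¹).mono' (Measurable.aestronglyMeasurable (by have := h.meas; fun_prop)) (Filter.Eventually.of_forall fun x => ?_)
  rw [Real.norm_of_nonneg (by positivity), inv_mul_eq_div, le_div_iff₀ h0]
  exact h.sqrt_le x

lemma GoodF.int_sqrt_le {F : ℝ → ℝ} (h : GoodF F) : ∫ x, √(F x) ≤ 2 / √(F 0) := by
  have h0 := Real.sqrt_pos.2 h.zero_pos
  rw [le_div_iff₀ h0, ← integral_mul_const]
  calc ∫ x, √(F x) * √(F 0) ≤ ∫ x, F (x/2) := integral_mono (h.sqrt_int.mul_const _) h.comp_half_int h.sqrt_le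
    _ = 2 := by rw [Measure.integral_comp_div F 2, h.one]; simp

def lineI (w : ℝ × ℝ → ℝ) (c : ℝ) : ℝ := mgW (shearW c w) 0
def horI (w : ℝ × ℝ → ℝ) : ℝ := mgW (swapW w) 0

lemma lineI_eq (w : ℝ × ℝ → ℝ) (c : ℝ) : lineI w c = ∫ y, w (c * y, y) := by
  simp [lineI, mgW, shearW]

lemma GoodW.lineI_pos {w : ℝ × ℝ → ℝ} (h : GoodW w) (c : ℝ) : 0 < lineI w c := (h.shear c).mg.zero_pos
lemma GoodW.horI_pos {w : ℝ × ℝ → ℝ} (h : GoodW w) : 0 < horI w := h.swap.mg.zero_pos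

lemma GoodW.lineI_int {w : ℝ × ℝ → ℝ} (h : GoodW w) (c : ℝ) : Integrable (fun y => w (c * y, y)) := by
  have := (h.shear c).axis_int
  simpa [shearW] using this

lemma GoodW.horI_int {w : ℝ × ℝ → ℝ} (h : GoodW w) : Integrable (fun y => w (y, 0)) := by
  have := h.swap.axis_int
  simpa [swapW] using this

lemma GoodW.dir1_int {w : ℝ × ℝ → ℝ} (h : GoodW w) (c : ℝ) : Integrable (fun s : ℝ => w (s • ((c, 1) : ℝ × ℝ))) := by
  refine (h.lineI_int c).congr (Filter.Eventually.of_forall fun y => ?_)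
  simp [mul_comm]

lemma GoodW.dir1 {w : ℝ × ℝ → ℝ} (c : ℝ) : ∫ s : ℝ, w (s • ((c, 1) : ℝ × ℝ)) = lineI w c := by
  rw [lineI_eq]; simp [mul_comm]

lemma GoodW.dir1'_int {w : ℝ × ℝ → ℝ} (h : GoodW w) (c : ℝ) : Integrable (fun s : ℝ => w (s • ((-c, -1) : ℝ × ℝ))) := by
  refine (h.dir1_int c).congr (Filter.Eventually.of_forall fun y => ?_)
  dsimp only
  rw [← h.even]
  simp

lemma GoodW.dir1' {w : ℝ × ℝ → ℝ} (h : GoodW w) (c : ℝ) : ∫ s : ℝ, w (s • ((-c, -1) : ℝ × ℝ)) = lineI w c := by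
  rw [← GoodW.dir1]
  congr 1
  funext y
  rw [← h.even]
  simp

lemma GoodW.dir2_int {w : ℝ × ℝ → ℝ} (h : GoodW w) {c : ℝ} (hc : c ≠ 0) : Integrable (fun s : ℝ => w (s • ((c, 0) : ℝ × ℝ))) := by
  refine ((integrable_comp_mul_left_iff (fun y => w (y, 0)) hc).2 h.horI_int).congr (Filter.Eventually.of_forall fun y => ?_)
  simp [mul_comm]

lemma GoodW.dir2 {w : ℝ × ℝ → ℝ} (c : ℝ) : ∫ s : ℝ, w (s • ((c, 0) : ℝ × ℝ)) = horI w / |c| := by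
  have := Measure.integral_comp_mul_left (fun y => w (y, 0)) c
  simp only [horI, mgW, swapW]
  rw [div_eq_inv_mul, ← abs_inv, ← smul_eq_mul, ← this]
  simp [mul_comm]

lemma GoodW.bus1 {w : ℝ × ℝ → ℝ} (h : GoodW w) (c c' : ℝ) :
    1 / lineI w c' ≤ 1 / lineI w c + |c' - c| / horI w := by
  rcases eq_or_ne c' c with rfl | hne
  · simp
  have hne' : c' - c ≠ 0 := sub_ne_zero.2 hne
  have e : ((c, 1) : ℝ × ℝ) + (c' - c, 0) = (c', 1) := by ext <;> simp
  have := busemann_dir h.lc h.even (c, 1) (c' - c, 0) (h.dir1_int c) (h.dir2_int hne') (by rw [e]; exact h.dir1_int c')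
    (by rw [GoodW.dir1]; exact h.lineI_pos c) (by rw [GoodW.dir2]; exact div_pos h.horI_pos (abs_pos.2 hne'))
  rw [e, GoodW.dir1, GoodW.dir1, GoodW.dir2, one_div_div] at this
  exact this

lemma GoodW.bus2 {w : ℝ × ℝ → ℝ} (h : GoodW w) (c c' : ℝ) :
    |c' - c| / horI w ≤ 1 / lineI w c + 1 / lineI w c' := by
  rcases eq_or_ne c' c with rfl | hne
  · have := h.lineI_pos c'
    simp; positivity
  have hne' : c' - c ≠ 0 := sub_ne_zero.2 hne
  have e : ((-c, -1) : ℝ × ℝ) + (c', 1) = (c' - c, 0) := by ext <;> simp; ring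
  have := busemann_dir h.lc h.even (-c, -1) (c', 1) (h.dir1'_int c) (h.dir1_int c') (by rw [e]; exact h.dir2_int hne')
    (by rw [h.dir1']; exact h.lineI_pos c) (by rw [GoodW.dir1]; exact h.lineI_pos c')
  rw [e, h.dir1', GoodW.dir1, GoodW.dir2, one_div_div] at this
  exact this

/-- existence of the maximizing direction -/
lemma GoodW.exists_max {w : ℝ × ℝ → ℝ} (h : GoodW w) :
    ∃ c, (∀ c', lineI w c' ≤ lineI w c) ∧ |c| ≤ 2 * horI w / lineI w 0 := by
  have hm := h.horI_pos
  set N : ℝ → ℝ := fun c => 1 / lineI w c with hN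
  have hcont : Continuous N := by
    have : LipschitzWith (Real.toNNReal (1 / horI w)) N := by
      apply LipschitzWith.of_le_add_mul
      intro x y
      have := h.bus1 y x
      rw [Real.coe_toNNReal _ (by positivity), Real.dist_eq, one_div_mul_eq_div]
      exact this
    exact this.continuous
  have hlim : Filter.Tendsto N (Filter.cocompact ℝ) Filter.atTop := by
    have h1 : Filter.Tendsto (fun c : ℝ => |c| / horI w - 1 / lineI w 0) (Filter.cocompact ℝ) Filter.atTop := by
      apply Filter.tendsto_atTop_add_const_right
      exact (tendsto_norm_cocompact_atTop (E := ℝ)).atTop_div_const hm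
    refine Filter.tendsto_atTop_mono (fun c => ?_) h1
    have := h.bus2 0 c
    simp only [sub_zero] at this
    simp only [hN]
    linarith
  obtain ⟨c, hc⟩ := hcont.exists_forall_le hlim
  refine ⟨c, fun c' => ?_, ?_⟩
  · exact (one_div_le_one_div (h.lineI_pos c) (h.lineI_pos c')).1 (hc c')
  · have h1 := h.bus2 0 c
    have h2 := hc 0
    simp only [hN] at h2
    rw [sub_zero, div_le_iff₀ hm] at h1
    have : |c| ≤ (1 / lineI w 0 + 1 / lineI w 0) * horI w := h1.trans (by gcongr)
    refine this.trans (le_of_eq ?_)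
    ring

/-- first moment bound for a half-line log-concave function -/
lemma lc_sub {f : ℝ → ℝ} (hf : IsLogConcaveFn f) {y s : ℝ} (hy : 0 < y) (hs : 0 < s) (h0 : 0 < f 0) :
    f 0 * f (y + s) ≤ f y * f s := by
  have h1 := hf.2 (y + s) 0 (y / (y + s)) (by positivity) (by rw [div_le_one (by positivity)]; linarith)
  have h2 := hf.2 (y + s) 0 (s / (y + s)) (by positivity) (by rw [div_le_one (by positivity)]; linarith)
  have e1 : (y / (y + s)) • (y + s) + (1 - y / (y + s)) • (0:ℝ) = y := by simp; field_simp
  have e2 : (s / (y + s)) • (y + s) + (1 - s / (y + s)) • (0:ℝ) = s := by simp; field_simp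
  have e3 : s / (y + s) = 1 - y / (y + s) := by field_simp; ring
  rw [e1] at h1
  rw [e2] at h2
  rcases (hf.1 (y + s)).eq_or_lt with hz | hp
  · rw [← hz, mul_zero]; exact mul_nonneg (hf.1 _) (hf.1 _)
  refine le_trans (le_of_eq ?_) (mul_le_mul h1 h2 (by positivity) (hf.1 _))
  rw [e3]
  set l := y / (y + s)
  have a1 : f (y + s) ^ l * f (y + s) ^ (1 - l) = f (y + s) := by rw [← rpow_add hp]; simp
  have a2 : f 0 ^ (1 - l) * f 0 ^ (1 - (1 - l)) = f 0 := by rw [← rpow_add h0]; simp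
  calc f 0 * f (y + s) = (f 0 ^ (1 - l) * f 0 ^ (1 - (1 - l))) * (f (y + s) ^ l * f (y + s) ^ (1 - l)) := by rw [a1, a2]
    _ = _ := by ring

lemma moment_half {f : ℝ → ℝ} (hm : Measurable f) (hf : IsLogConcaveFn f) (h0 : 0 < f 0) :
    ENNReal.ofReal (f 0) * ∫⁻ t in Set.Ioi (0:ℝ), ENNReal.ofReal t * ENNReal.ofReal (f t)
      ≤ (∫⁻ t in Set.Ioi (0:ℝ), ENNReal.ofReal (f t)) ^ 2 := by
  have h1 : ∫⁻ t in Set.Ioi (0:ℝ), ENNReal.ofReal t * ENNReal.ofReal (f t)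
      = ∫⁻ y in Set.Ioi (0:ℝ), ∫⁻ s in Set.Ioi (0:ℝ), ENNReal.ofReal (f (y + s)) := by
    calc ∫⁻ t in Set.Ioi (0:ℝ), ENNReal.ofReal t * ENNReal.ofReal (f t)
        = ∫⁻ t in Set.Ioi (0:ℝ), ∫⁻ y in Set.Ioi (0:ℝ), (Set.Ioi y).indicator (fun t => ENNReal.ofReal (f t)) t := by
          apply setLIntegral_congr_fun measurableSet_Ioi
          intro t ht
          have : ∀ y, (Set.Ioi y).indicator (fun t => ENNReal.ofReal (f t)) t = (Set.Iio t).indicator (fun _ => ENNReal.ofReal (f t)) y := by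
            intro y; simp [Set.indicator]
          simp only [this]
          rw [setLIntegral_indicator measurableSet_Iio, setLIntegral_const, mul_comm]
          congr 1
          rw [Set.inter_comm, Set.Ioi_inter_Iio]
          simp
      _ = ∫⁻ y in Set.Ioi (0:ℝ), ∫⁻ t in Set.Ioi (0:ℝ), (Set.Ioi y).indicator (fun t => ENNReal.ofReal (f t)) t := by
          rw [lintegral_lintegral_swap]
          apply Measurable.aemeasurable
          have : (Function.uncurry fun (t : ℝ) (y : ℝ) => (Set.Ioi y).indicator (fun t => ENNReal.ofReal (f t)) t)
              = Set.indicator {z : ℝ × ℝ | z.2 < z.1} (fun z => ENNReal.ofReal (f z.1)) := by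
            funext z; simp [Function.uncurry, Set.indicator]
          rw [this]
          exact Measurable.indicator (by fun_prop) (measurableSet_lt measurable_snd measurable_fst)
      _ = _ := by
          apply setLIntegral_congr_fun measurableSet_Ioi
          intro y hy
          dsimp only
          rw [setLIntegral_indicator measurableSet_Ioi, Set.inter_eq_left.2 (Set.Ioi_subset_Ioi (le_of_lt hy))]
          rw [← lintegral_indicator measurableSet_Ioi, ← lintegral_indicator measurableSet_Ioi,
            ← lintegral_add_left_eq_self _ y]
          congr 1
          funext s
          simp [Set.indicator]
  rw [h1, sq, ← lintegral_const_mul _ (by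
    have : Measurable (Function.uncurry fun y s : ℝ => ENNReal.ofReal (f (y + s))) := by fun_prop
    exact this.lintegral_prod_right), ← lintegral_const_mul _ (by fun_prop)]
  apply setLIntegral_mono' measurableSet_Ioi
  intro y hy
  rw [← lintegral_const_mul _ (by fun_prop), mul_comm, ← lintegral_const_mul _ (by fun_prop)]
  apply setLIntegral_mono' measurableSet_Ioi
  intro s hs
  rw [← ENNReal.ofReal_mul h0.le, ← ENNReal.ofReal_mul (hf.1 _)]
  exact ENNReal.ofReal_le_ofReal (lc_sub hf hy hs h0)


lemma even_lint {g : ℝ → ℝ≥0∞} (he : ∀ x, g (-x) = g x) :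
    ∫⁻ x, g x = 2 * ∫⁻ x in Set.Ioi (0:ℝ), g x := by
  have h1 : ∫⁻ x in Set.Iio (0:ℝ), g x = ∫⁻ x in Set.Ioi (0:ℝ), g x := by
    have mp : MeasurePreserving (fun x : ℝ => -x) := Measure.measurePreserving_neg volume
    have := mp.setLIntegral_comp_preimage_emb (MeasurableEquiv.neg ℝ).measurableEmbedding g (Set.Ioi 0)
    simp only [he] at this
    rw [← this]
    congr 2
    ext; simp
  rw [← lintegral_add_compl g measurableSet_Ioi (A := Set.Ioi (0:ℝ)), Set.compl_Ioi, setLIntegral_congr Iio_ae_eq_Iic.symm, h1, two_mul]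

lemma second_half {f : ℝ → ℝ} (hm : Measurable f) (_hf0 : ∀ x, 0 ≤ f x) (hanti : ∀ x y, 0 < x → x ≤ y → f y ≤ f x) :
    2 * ∫⁻ t in Set.Ioi (0:ℝ), ENNReal.ofReal t * ENNReal.ofReal (f t) ^ 2
      ≤ (∫⁻ t in Set.Ioi (0:ℝ), ENNReal.ofReal (f t)) ^ 2 := by
  set G : ℝ → ℝ≥0∞ := fun t => ENNReal.ofReal (f t) with hG
  have hGm : Measurable G := by fun_prop
  set K1 : ℝ → ℝ → ℝ≥0∞ := fun t s => if s < t then G s * G t else 0 with hK1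
  have hK1m : Measurable (Function.uncurry K1) := by
    apply Measurable.ite (measurableSet_lt measurable_snd measurable_fst) (by fun_prop) (by fun_prop)
  have h1 : ∫⁻ t in Set.Ioi (0:ℝ), ENNReal.ofReal t * ENNReal.ofReal (f t) ^ 2
      ≤ ∫⁻ t in Set.Ioi (0:ℝ), ∫⁻ s in Set.Ioi (0:ℝ), K1 t s := by
    apply setLIntegral_mono' measurableSet_Ioi
    intro t ht
    calc ENNReal.ofReal t * ENNReal.ofReal (f t) ^ 2 = ∫⁻ s in Set.Ioo 0 t, ENNReal.ofReal (f t) ^ 2 := by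
          rw [setLIntegral_const, mul_comm]; simp
      _ ≤ ∫⁻ s in Set.Ioo 0 t, K1 t s := by
          apply setLIntegral_mono' measurableSet_Ioo
          intro s hs
          simp only [hK1, hs.2, if_true, hG]
          rw [sq]
          gcongr
          exact hanti s t hs.1 hs.2.le
      _ ≤ _ := lintegral_mono_set Set.Ioo_subset_Ioi_self
  have h2 : ∫⁻ t in Set.Ioi (0:ℝ), ∫⁻ s in Set.Ioi (0:ℝ), K1 t s = ∫⁻ t in Set.Ioi (0:ℝ), ∫⁻ s in Set.Ioi (0:ℝ), K1 s t := by
    rw [lintegral_lintegral_swap hK1m.aemeasurable]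
  calc _ ≤ 2 * ∫⁻ t in Set.Ioi (0:ℝ), ∫⁻ s in Set.Ioi (0:ℝ), K1 t s := by gcongr
    _ = (∫⁻ t in Set.Ioi (0:ℝ), ∫⁻ s in Set.Ioi (0:ℝ), K1 t s) + ∫⁻ t in Set.Ioi (0:ℝ), ∫⁻ s in Set.Ioi (0:ℝ), K1 s t := by
        rw [two_mul, ← h2]
    _ = ∫⁻ t in Set.Ioi (0:ℝ), ∫⁻ s in Set.Ioi (0:ℝ), (K1 t s + K1 s t) := by
        rw [← lintegral_add_left hK1m.lintegral_prod_right]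
        congr 1; funext t
        rw [lintegral_add_left]
        exact hK1m.comp (measurable_const.prodMk measurable_id)
    _ ≤ ∫⁻ t in Set.Ioi (0:ℝ), ∫⁻ s in Set.Ioi (0:ℝ), G t * G s := by
        apply lintegral_mono; intro t
        apply lintegral_mono; intro s
        simp only [hK1]
        split_ifs with a b b
        · exact absurd a (not_lt.2 b.le)
        · simp [mul_comm]
        · simp
        · simp
    _ = _ := by
        rw [sq, ← lintegral_mul_const _ hGm]
        congr 1; funext t
        rw [lintegral_const_mul _ hGm]

lemma GoodF.lint_half {F : ℝ → ℝ} (h : GoodF F) : ∫⁻ t in Set.Ioi (0:ℝ), ENNReal.ofReal (F t) = ENNReal.ofReal (1/2) := by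
  rw [← ofReal_integral_eq_lintegral_ofReal h.int.integrableOn (Filter.Eventually.of_forall h.lc.1),
    even_half h.even h.int, h.one]

lemma GoodF.second_moment {F : ℝ → ℝ} (h : GoodF F) :
    ∫⁻ t, ENNReal.ofReal (|t| * F t ^ 2) ≤ ENNReal.ofReal (1/4) := by
  rw [even_lint (by intro x; rw [abs_neg, h.even])]
  have h1 := second_half h.meas h.lc.1 (fun x y hx hxy => h.anti hx.le hxy)
  rw [h.lint_half] at h1
  calc 2 * ∫⁻ t in Set.Ioi (0:ℝ), ENNReal.ofReal (|t| * F t ^ 2) = 2 * ∫⁻ t in Set.Ioi (0:ℝ), ENNReal.ofReal t * ENNReal.ofReal (F t) ^ 2 := by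
        congr 1
        apply setLIntegral_congr_fun measurableSet_Ioi
        intro t ht
        dsimp only
        rw [abs_of_pos ht, ENNReal.ofReal_mul (le_of_lt ht), ENNReal.ofReal_pow (h.lc.1 t)]
    _ ≤ _ := h1
    _ = _ := by rw [← ENNReal.ofReal_pow (by norm_num)]; norm_num

/-- the polar-coordinate bound -/
lemma GoodW.polar {w : ℝ × ℝ → ℝ} (h : GoodW w) :
    1 ≤ ∫⁻ c, ENNReal.ofReal (lineI w c ^ 2 / (2 * w 0)) := by
  have hw0 := h.zero_pos
  have hwm := h.meas
  have h1 : ∫⁻ z, ENNReal.ofReal (w z) = 1 := by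
    rw [← ofReal_integral_eq_lintegral_ofReal h.int (Filter.Eventually.of_forall h.lc.1), h.one, ENNReal.ofReal_one]
  rw [← h1, Measure.volume_eq_prod, lintegral_prod_symm _ (by fun_prop)]
  calc ∫⁻ y, ∫⁻ x, ENNReal.ofReal (w (x, y)) = ∫⁻ y, ∫⁻ c, ENNReal.ofReal (|y| * w (c * y, y)) := by
        apply lintegral_congr_ae
        have : ∀ᵐ y : ℝ, y ≠ 0 := by simp [ae_iff]
        filter_upwards [this] with y hy
        have hab : 0 < |y| := abs_pos.2 hy
        have hsc : ∫⁻ x, ENNReal.ofReal (w (x, y)) = ENNReal.ofReal |y| * ∫⁻ c, ENNReal.ofReal (w (c * y, y)) := by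
          have := lintegral_image_eq_lintegral_abs_deriv_mul (s := Set.univ) (f := fun c : ℝ => c * y) (f' := fun _ => y) MeasurableSet.univ
            (fun c _ => ((hasDerivAt_id c).mul_const y |>.congr_deriv (by simp)).hasDerivWithinAt)
            (fun a _ b _ hab => mul_right_cancel₀ hy hab) (fun x => ENNReal.ofReal (w (x, y)))
          rw [lintegral_const_mul _ (by fun_prop), Set.image_univ, (mul_right_surjective₀ hy).range_eq] at this
          simpa using this
        rw [hsc, ← lintegral_const_mul _ (by fun_prop)]
        simp only [ENNReal.ofReal_mul hab.le]
    _ = ∫⁻ c, ∫⁻ y, ENNReal.ofReal (|y| * w (c * y, y)) := by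
        rw [lintegral_lintegral_swap]
        apply Measurable.aemeasurable
        simp only [Function.uncurry_def]
        fun_prop
    _ ≤ _ := by
        apply lintegral_mono
        intro c
        dsimp only
        have hev : ∀ y : ℝ, w (c * (-y), -y) = w (c * y, y) := by
          intro y; rw [← h.even (c * y, y)]; congr 1; ext <;> simp
        have hlc : IsLogConcaveFn (fun y : ℝ => w (c * y, y)) := by
          have := lc_line0 h.lc (c, 1)
          simpa [mul_comm] using this
        have hm : Measurable (fun y : ℝ => w (c * y, y)) := by fun_prop
        have mh := moment_half hm hlc (by simp only [mul_zero]; exact hw0)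
        simp only [mul_zero] at mh
        change ENNReal.ofReal (w 0) * _ ≤ _ at mh
        rw [← ofReal_integral_eq_lintegral_ofReal (h.lineI_int c).integrableOn (Filter.Eventually.of_forall fun y => h.lc.1 _),
          even_half (f := fun y : ℝ => w (c * y, y)) hev (h.lineI_int c), ← lineI_eq] at mh
        rw [even_lint (by intro x; rw [abs_neg, hev])]
        have e : ∫⁻ y in Set.Ioi (0:ℝ), ENNReal.ofReal (|y| * w (c * y, y)) = ∫⁻ y in Set.Ioi (0:ℝ), ENNReal.ofReal y * ENNReal.ofReal (w (c * y, y)) := by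
          apply setLIntegral_congr_fun measurableSet_Ioi
          intro t ht
          dsimp only
          rw [abs_of_pos ht, ENNReal.ofReal_mul (le_of_lt ht)]
        rw [e]
        set T := ∫⁻ y in Set.Ioi (0:ℝ), ENNReal.ofReal y * ENNReal.ofReal (w (c * y, y))
        have hT : T ≤ (ENNReal.ofReal (lineI w c / 2) ^ 2) / ENNReal.ofReal (w 0) := by
          rw [ENNReal.le_div_iff_mul_le (Or.inl (by simpa using hw0)) (Or.inl ENNReal.ofReal_ne_top), mul_comm]
          exact mh
        have hI := h.lineI_pos c
        calc 2 * T ≤ 2 * ((ENNReal.ofReal (lineI w c / 2) ^ 2) / ENNReal.ofReal (w 0)) := by gcongr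
          _ = ENNReal.ofReal (2 * ((lineI w c / 2) ^ 2 / w 0)) := by
            rw [ENNReal.ofReal_mul (by norm_num), ENNReal.ofReal_div_of_pos hw0, ENNReal.ofReal_pow (by positivity)]
            simp
          _ = _ := by congr 1; field_simp

lemma GoodW.w0_le {w : ℝ × ℝ → ℝ} (h : GoodW w) (hmax : ∀ c, lineI w c ≤ lineI w 0) :
    w 0 ≤ 3 * horI w * lineI w 0 := by
  have hw0 := h.zero_pos
  have hm := h.horI_pos
  have hI := h.lineI_pos 0
  set m := horI w
  set I := lineI w 0
  have hpol := h.polar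
  set r := 2 * m / I with hr
  have hr0 : 0 < r := by positivity
  -- tail integrand
  set G : ℝ → ℝ := fun c => -m / (c / m - 1 / I) with hG
  set G' : ℝ → ℝ := fun c => ((c / m - 1 / I) ^ 2)⁻¹ with hG'
  have hpos : ∀ c, r ≤ c → 0 < c / m - 1 / I := by
    intro c hc
    have : r / m ≤ c / m := by gcongr
    have e : r / m = 2 / I := by rw [hr]; field_simp
    have : 0 < 1 / I := by positivity
    have : 2 / I = 1 / I + 1 / I := by ring
    linarith
  have hd : ∀ c, r ≤ c → HasDerivAt G (G' c) c := by
    intro c hc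
    have h1 : HasDerivAt (fun c : ℝ => c / m - 1 / I) (1 / m) c := ((hasDerivAt_id c).div_const m).sub_const _
    have h2 := (h1.inv (hpos c hc).ne').const_mul (-m)
    have e : -m * (-(1 / m) / (c / m - 1 / I) ^ 2) = G' c := by
      simp only [hG']
      field_simp
    rw [e] at h2
    exact h2
  have hlim : Filter.Tendsto G Filter.atTop (nhds 0) := by
    have h1 : Filter.Tendsto (fun c : ℝ => c / m - 1 / I) Filter.atTop Filter.atTop :=
      Filter.tendsto_atTop_add_const_right _ _ (Filter.tendsto_id.atTop_div_const hm)
    have := h1.inv_tendsto_atTop.const_mul (-m)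
    simpa [hG, div_eq_mul_inv] using this
  have hIntg : IntegrableOn G' (Set.Ioi r) :=
    integrableOn_Ioi_deriv_of_nonneg (hd r le_rfl).continuousAt.continuousWithinAt (fun c hc => hd c (le_of_lt hc))
      (fun c hc => by simp only [hG']; positivity) hlim
  have hval : ∫ c in Set.Ioi r, G' c = m * I := by
    rw [integral_Ioi_of_hasDerivAt_of_nonneg (hd r le_rfl).continuousAt.continuousWithinAt (fun c hc => hd c (le_of_lt hc))
      (fun c hc => by simp only [hG']; positivity) hlim]
    simp only [hG, hr]
    field_simp
    norm_num
  have hIle : ∀ c, r < |c| → lineI w c ^ 2 ≤ G' |c| := by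
    intro c hc
    have h1 := h.bus2 0 c
    rw [sub_zero] at h1
    have hp := hpos |c| hc.le
    have hIc := h.lineI_pos c
    have h2 : |c| / m - 1 / I ≤ 1 / lineI w c := by simp only [I, m]; linarith
    have h3 : lineI w c ≤ (|c| / m - 1 / I)⁻¹ := by
      rw [le_inv_comm₀ hIc hp, ← one_div]; exact h2
    simp only [hG', ← inv_pow]
    gcongr
  have hbound : ∫⁻ c, ENNReal.ofReal (lineI w c ^ 2 / (2 * w 0)) ≤ ENNReal.ofReal (3 * m * I / w 0) := by
    set k := 1 / (2 * w 0) with hk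
    have hk0 : 0 < k := by positivity
    calc ∫⁻ c, ENNReal.ofReal (lineI w c ^ 2 / (2 * w 0)) ≤
        ∫⁻ c, ENNReal.ofReal (if |c| ≤ r then k * I ^ 2 else k * G' |c|) := by
          apply lintegral_mono
          intro c
          apply ENNReal.ofReal_le_ofReal
          have hIc := h.lineI_pos c
          rw [div_eq_mul_one_div, mul_comm]
          split_ifs with hc
          · have := hmax c
            gcongr
          · have := hIle c (not_le.1 hc)
            gcongr
      _ = 2 * ∫⁻ c in Set.Ioi (0:ℝ), ENNReal.ofReal (if |c| ≤ r then k * I ^ 2 else k * G' |c|) := by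
          apply even_lint; intro x; simp
      _ ≤ 2 * (ENNReal.ofReal (k * I ^ 2 * r) + ENNReal.ofReal (k * (m * I))) := by
          gcongr
          rw [← Set.Ioc_union_Ioi_eq_Ioi hr0.le]
          refine (lintegral_union_le _ _ _).trans ?_
          gcongr
          · calc ∫⁻ c in Set.Ioc 0 r, ENNReal.ofReal (if |c| ≤ r then k * I ^ 2 else k * G' |c|) = ∫⁻ c in Set.Ioc 0 r, ENNReal.ofReal (k * I ^ 2) := by
                  apply setLIntegral_congr_fun measurableSet_Ioc
                  intro c hc
                  dsimp only
                  rw [abs_of_pos hc.1, if_pos hc.2]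
              _ ≤ _ := by
                  rw [setLIntegral_const, Real.volume_Ioc, sub_zero, ← ENNReal.ofReal_mul (by positivity)]
          · calc ∫⁻ c in Set.Ioi r, ENNReal.ofReal (if |c| ≤ r then k * I ^ 2 else k * G' |c|) = ∫⁻ c in Set.Ioi r, ENNReal.ofReal (k * G' c) := by
                  apply setLIntegral_congr_fun measurableSet_Ioi
                  intro c hc
                  have hc' : r < c := hc
                  dsimp only
                  rw [abs_of_pos (hr0.trans hc'), if_neg (not_le.2 hc')]
              _ ≤ _ := by
                  rw [← ofReal_integral_eq_lintegral_ofReal (hIntg.const_mul k)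
                    (Filter.Eventually.of_forall fun c => by simp only [hG', Pi.zero_apply]; positivity), integral_const_mul, hval]
      _ = ENNReal.ofReal (2 * (k * I ^ 2 * r + k * (m * I))) := by
          rw [ENNReal.ofReal_mul zero_le_two, ENNReal.ofReal_add (by positivity) (by positivity)]; simp
      _ = _ := by
          congr 1
          rw [hk, hr]
          field_simp
          ring
  have h1 := hpol.trans hbound
  rw [← ENNReal.ofReal_one, ENNReal.ofReal_le_ofReal_iff (by positivity), one_le_div hw0] at h1
  exact h1

lemma GoodW.w_le {w : ℝ × ℝ → ℝ} (h : GoodW w) (u v : ℝ) :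
    w (u, v) ≤ 4 * w 0 * (mgW w (u / 2) / lineI w 0) ^ 2 := by
  have hw0 := h.zero_pos
  have hI := h.lineI_pos 0
  have hs0 := Real.sqrt_pos.2 hw0
  have hIntg : Integrable (fun y : ℝ => w (0, 2 * y - v)) := by
    have h1 := (integrable_comp_mul_left_iff (fun y => w (0, y - v)) (two_ne_zero (α := ℝ))).2 (h.axis_int.comp_sub_right v)
    exact h1
  have key : √(w (u, v)) / √(w 0) * (lineI w 0 / 2) ≤ mgW w (u / 2) := by
    have e : ∫ y, w (0, 2 * y - v) = lineI w 0 / 2 := by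
      have := Measure.integral_comp_mul_left (fun y => w (0, y - v)) 2
      rw [this, integral_sub_right_eq_self (fun y => w (0, y)) v, lineI_eq]
      simp; ring
    rw [← e, ← integral_const_mul]
    apply integral_mono (hIntg.const_mul _) (h.slice_int _)
    intro y
    dsimp only
    have h1 := lc_mid h.lc (u, v) (0, 2 * y - v) (u / 2, y) (by ext <;> simp <;> ring)
    refine le_trans ?_ h1
    rw [div_mul_eq_mul_div, div_le_iff₀ hs0]
    have h2 : w (0, 2 * y - v) ≤ √(w (0, 2 * y - v)) * √(w 0) := by
      calc w (0, 2 * y - v) = √(w (0, 2 * y - v)) * √(w (0, 2 * y - v)) := (Real.mul_self_sqrt (h.lc.1 _)).symm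
        _ ≤ _ := by gcongr; exact h.le_zero _
    calc √(w (u, v)) * w (0, 2 * y - v) ≤ √(w (u, v)) * (√(w (0, 2 * y - v)) * √(w 0)) := by gcongr
      _ = _ := by ring
  have h3 : √(w (u, v)) ≤ 2 * √(w 0) * (mgW w (u / 2) / lineI w 0) := by
    have : √(w (u, v)) = (√(w (u, v)) / √(w 0) * (lineI w 0 / 2)) * (2 * √(w 0) / lineI w 0) := by field_simp
    rw [this]
    calc _ ≤ mgW w (u / 2) * (2 * √(w 0) / lineI w 0) := by gcongr
      _ = _ := by ring
  calc w (u, v) = √(w (u, v)) ^ 2 := (Real.sq_sqrt (h.lc.1 _)).symm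
    _ ≤ (2 * √(w 0) * (mgW w (u / 2) / lineI w 0)) ^ 2 := by gcongr
    _ = _ := by rw [mul_pow, mul_pow, Real.sq_sqrt hw0.le]; norm_num

/-- translation bound for quasi-concave functions -/
lemma tv_bound {f : ℝ → ℝ} (hm : Measurable f) (hf : IsLogConcaveFn f) {B : ℝ} (hB : ∀ x, f x ≤ B) (d : ℝ) :
    ∫⁻ v, ENNReal.ofReal (f v - f (v - d)) ≤ ENNReal.ofReal (|d| * B) := by
  have hB0 : 0 ≤ B := (hf.1 0).trans (hB 0)
  have hquasi : ∀ τ x y z, x ≤ z → z ≤ y → 0 ≤ τ → τ < f x → τ < f y → τ < f z := by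
    intro τ x y z hxz hzy hτ hx hy
    rcases (hxz.trans hzy).eq_or_lt with e | hxy
    · have : z = x := by linarith
      rw [this]; exact hx
    have hyx : 0 < y - x := by linarith
    have h1 := hf.2 x y ((y - z) / (y - x)) (div_nonneg (by linarith) hyx.le) (by rw [div_le_one hyx]; linarith)
    have e : ((y - z) / (y - x)) • x + (1 - (y - z) / (y - x)) • y = z := by
      simp only [smul_eq_mul]; field_simp; ring
    rw [e] at h1
    set l := (y - z) / (y - x)
    have hl0 : 0 ≤ l := div_nonneg (by linarith) hyx.le
    have hl1 : l ≤ 1 := by rw [div_le_one hyx]; linarith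
    set μ := min (f x) (f y)
    have hμ : τ < μ := lt_min hx hy
    have hμ0 : 0 < μ := by linarith
    calc τ < μ := hμ
      _ = μ ^ l * μ ^ (1 - l) := by rw [← rpow_add hμ0]; simp
      _ ≤ f x ^ l * f y ^ (1 - l) := by
        apply mul_le_mul
        · exact Real.rpow_le_rpow hμ0.le (min_le_left _ _) hl0
        · exact Real.rpow_le_rpow hμ0.le (min_le_right _ _) (by linarith)
        · positivity
        · exact rpow_nonneg (hf.1 _) _
      _ ≤ _ := h1
  calc ∫⁻ v, ENNReal.ofReal (f v - f (v - d)) = ∫⁻ v, ∫⁻ τ in Set.Ico 0 B, (if f (v - d) ≤ τ ∧ τ < f v then 1 else 0) := by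
        congr 1; funext v
        rw [← Real.volume_Ico]
        have : ∀ τ, (if f (v - d) ≤ τ ∧ τ < f v then (1:ℝ≥0∞) else 0) = (Set.Ico (f (v - d)) (f v)).indicator (fun _ => 1) τ := by
          intro τ; simp [Set.indicator, Set.mem_Ico]
        simp only [this]
        rw [setLIntegral_indicator measurableSet_Ico, setLIntegral_const, one_mul, Set.inter_eq_left.2]
        exact Set.Ico_subset_Ico (hf.1 _) (hB _)
    _ = ∫⁻ τ in Set.Ico 0 B, ∫⁻ v, (if f (v - d) ≤ τ ∧ τ < f v then 1 else 0) := by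
        rw [lintegral_lintegral_swap]
        apply Measurable.aemeasurable
        simp only [Function.uncurry_def]
        apply Measurable.ite _ measurable_const measurable_const
        apply MeasurableSet.inter
        · exact measurableSet_le (f := fun z : ℝ × ℝ => f (z.1 - d)) (by fun_prop) measurable_snd
        · exact measurableSet_lt (g := fun z : ℝ × ℝ => f z.1) measurable_snd (by fun_prop)
    _ ≤ ∫⁻ τ in Set.Ico 0 B, ENNReal.ofReal |d| := by
        apply setLIntegral_mono' measurableSet_Ico
        intro τ hτ
        have hms : MeasurableSet {v | f (v - d) ≤ τ ∧ τ < f v} := by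
          apply MeasurableSet.inter
          · exact measurableSet_le (f := fun v : ℝ => f (v - d)) (by fun_prop) measurable_const
          · exact measurableSet_lt (g := fun v : ℝ => f v) measurable_const (by fun_prop)
        have : ∀ v, (if f (v - d) ≤ τ ∧ τ < f v then (1:ℝ≥0∞) else 0) = {v | f (v - d) ≤ τ ∧ τ < f v}.indicator (fun _ => 1) v := by
          intro v; simp [Set.indicator]
        simp only [this]
        rw [lintegral_indicator hms, setLIntegral_const, one_mul]
        refine (Real.volume_le_diam _).trans ?_
        have hmain : ∀ x y, x ≤ y → x ∈ {v | f (v - d) ≤ τ ∧ τ < f v} → y ∈ {v | f (v - d) ≤ τ ∧ τ < f v} → y - x ≤ |d| := by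
          intro x y hxy hx hy
          by_contra! hcon
          rcases le_total 0 d with hd | hd
          · rw [abs_of_nonneg hd] at hcon
            exact absurd (hquasi τ x y (y - d) (by linarith) (by linarith) hτ.1 hx.2 hy.2) (not_lt.2 hy.1)
          · rw [abs_of_nonpos hd] at hcon
            exact absurd (hquasi τ x y (x - d) (by linarith) (by linarith) hτ.1 hx.2 hy.2) (not_lt.2 hx.1)
        apply Metric.ediam_le
        intro x hx y hy
        rw [edist_dist, Real.dist_eq]
        apply ENNReal.ofReal_le_ofReal
        rcases le_total x y with hxy | hxy
        · rw [abs_sub_comm, abs_of_nonneg (by linarith)]; exact hmain x y hxy hx hy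
        · rw [abs_of_nonneg (by linarith)]; exact hmain y x hxy hy hx
    _ = _ := by
        rw [setLIntegral_const, Real.volume_Ico, sub_zero, ENNReal.ofReal_mul (abs_nonneg _)]

lemma GoodF.rescale {F : ℝ → ℝ} (h : GoodF F) {s : ℝ} (hs : 0 < s) : GoodF (fun x => s * F (s * x)) := by
  have hm := h.meas
  refine ⟨by fun_prop, ⟨fun x => mul_nonneg hs.le (h.lc.1 _), ?_⟩, fun x => by simp only [mul_neg, h.even], ?_, ?_⟩
  · intro x y a h0 h1
    have := h.lc.2 (s * x) (s * y) a h0 h1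
    rw [mul_rpow hs.le (h.lc.1 _), mul_rpow hs.le (h.lc.1 _)]
    have e : s * (a • x + (1 - a) • y) = a • (s * x) + (1 - a) • (s * y) := by
      simp only [smul_eq_mul]; ring
    show _ ≤ s * F (s * (a • x + (1 - a) • y))
    rw [e]
    have e2 : s ^ a * s ^ (1 - a) = s := by rw [← rpow_add hs]; simp
    calc s ^ a * F (s * x) ^ a * (s ^ (1 - a) * F (s * y) ^ (1 - a)) = (s ^ a * s ^ (1 - a)) * (F (s * x) ^ a * F (s * y) ^ (1 - a)) := by ring
      _ ≤ _ := by rw [e2]; gcongr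
  · exact ((integrable_comp_mul_left_iff F hs.ne').2 h.int).const_mul s
  · rw [integral_const_mul, Measure.integral_comp_mul_left F s, h.one, abs_of_pos (by positivity)]
    simp [hs.ne']

lemma ofReal_integral_le {f : ℝ → ℝ} (hi : Integrable f) :
    ENNReal.ofReal (∫ x, f x) ≤ ∫⁻ x, ENNReal.ofReal (f x) := by
  have h1 : ∫ x, f x ≤ ∫ x, max (f x) 0 := integral_mono hi hi.pos_part (fun x => le_max_left _ _)
  refine (ENNReal.ofReal_le_ofReal h1).trans ?_
  rw [ofReal_integral_eq_lintegral_ofReal hi.pos_part (Filter.Eventually.of_forall fun x => le_max_right _ _)]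
  apply lintegral_mono
  intro x
  dsimp only
  rcases le_total 0 (f x) with h | h
  · rw [max_eq_left h]
  · rw [max_eq_right h]; simp

lemma GoodW.tv {w : ℝ × ℝ → ℝ} (h : GoodW w) (hmax : ∀ c, lineI w c ≤ lineI w 0) {k : ℝ} (hk : 0 < k) :
    ∫ v, max (mgW (swapW w) v - mgW (shearW (-k) (swapW w)) v) 0 ≤ k * (12 * horI w / lineI w 0) := by
  have hwm := h.meas
  have hw0 := h.zero_pos
  have hI := h.lineI_pos 0
  have hm := h.horI_pos
  have g1 := h.swap
  have g2 := h.swap.shear (-k)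
  have hIntg : Integrable (fun v => max (mgW (swapW w) v - mgW (shearW (-k) (swapW w)) v) 0) :=
    (g1.mg.int.sub g2.mg.int).pos_part
  rw [← ENNReal.ofReal_le_ofReal_iff (by positivity), ofReal_integral_eq_lintegral_ofReal hIntg (Filter.Eventually.of_forall fun x => le_max_right _ _)]
  have hF2 := h.mg.rescale (s := 1/2) (by norm_num)
  have hsm := hF2.second_moment
  set D := 16 * w 0 / lineI w 0 ^ 2 with hD
  have hD0 : 0 ≤ D := by positivity
  calc ∫⁻ v, ENNReal.ofReal (max (mgW (swapW w) v - mgW (shearW (-k) (swapW w)) v) 0)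
      ≤ ∫⁻ v, ∫⁻ u, ENNReal.ofReal (w (u, v) - w (u, v - k * u)) := by
        apply lintegral_mono
        intro v
        dsimp only
        have e : ENNReal.ofReal (max (mgW (swapW w) v - mgW (shearW (-k) (swapW w)) v) 0) = ENNReal.ofReal (mgW (swapW w) v - mgW (shearW (-k) (swapW w)) v) := by
          rcases le_total 0 (mgW (swapW w) v - mgW (shearW (-k) (swapW w)) v) with h | h
          · rw [max_eq_left h]
          · rw [max_eq_right h, ENNReal.ofReal_of_nonpos h, ENNReal.ofReal_zero]
        rw [e]
        simp only [mgW]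
        rw [← integral_sub (g1.slice_int v) (g2.slice_int v)]
        refine (ofReal_integral_le ((g1.slice_int v).sub (g2.slice_int v))).trans (le_of_eq ?_)
        congr 1; funext u
        have e3 : v + -k * u = v - k * u := by ring
        simp only [swapW, shearW, Pi.sub_apply, e3]
    _ = ∫⁻ u, ∫⁻ v, ENNReal.ofReal (w (u, v) - w (u, v - k * u)) := by
        rw [lintegral_lintegral_swap]
        apply Measurable.aemeasurable
        simp only [Function.uncurry_def]
        fun_prop
    _ ≤ ∫⁻ u, ENNReal.ofReal (k * D) * ENNReal.ofReal (|u| * (1/2 * mgW w (1/2 * u)) ^ 2) := by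
        apply lintegral_mono
        intro u
        dsimp only
        have hl : IsLogConcaveFn (fun v : ℝ => w (u, v)) := by
          simpa using lc_line h.lc (u, 0) (0, 1)
        refine (tv_bound (f := fun v => w (u, v)) (by fun_prop) hl (fun v => h.w_le u v) (k * u)).trans ?_
        rw [← ENNReal.ofReal_mul (by positivity)]
        apply ENNReal.ofReal_le_ofReal
        rw [abs_mul, abs_of_pos hk, hD, show (1/2 * u) = u / 2 by ring]
        apply le_of_eq
        field_simp
        ring
    _ = ENNReal.ofReal (k * D) * ∫⁻ u, ENNReal.ofReal (|u| * (1/2 * mgW w (1/2 * u)) ^ 2) := by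
        rw [lintegral_const_mul _ (by have := h.mg.meas; fun_prop)]
    _ ≤ ENNReal.ofReal (k * D) * ENNReal.ofReal (1/4) := by gcongr
    _ = ENNReal.ofReal (k * D * (1/4)) := by rw [← ENNReal.ofReal_mul (by positivity)]
    _ ≤ _ := by
        apply ENNReal.ofReal_le_ofReal
        rw [mul_assoc]
        gcongr
        rw [hD, div_mul_eq_mul_div, div_le_div_iff₀ (by positivity) hI]
        have := h.w0_le hmax
        nlinarith [mul_le_mul_of_nonneg_right this hI.le]


lemma pt1 {p f g m : ℝ} (hp : 1 < p) (hf : 0 ≤ f) (hfm : f ≤ m) (hg : 0 ≤ g) (hfg : g ≤ f) :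
    f ^ p - g ^ p - m ^ (p-1) * (f - g) ≤ (p - 1) * m ^ (p-1) * (f - g) := by
  rcases hf.eq_or_lt with h0 | hf
  · have : g = 0 := by linarith
    subst this; rw [← h0]; simp
  have h1 : f ^ p - g ^ p ≤ p * f ^ (p-1) * (f - g) := by
    have hgf : 0 ≤ g / f := by positivity
    have hb := one_add_mul_self_le_rpow_one_add (s := g / f - 1) (by linarith) hp.le
    rw [add_sub_cancel, Real.div_rpow hg hf.le] at hb
    have hfp : 0 < f ^ p := rpow_pos_of_pos hf _
    rw [le_div_iff₀ hfp] at hb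
    have e : f ^ p = f ^ (p-1) * f := by rw [← rpow_add_one hf.ne', sub_add_cancel]
    have e2 : (1 + p * (g / f - 1)) * f ^ p = f ^ p - p * f ^ (p-1) * (f - g) := by
      rw [e]; field_simp; ring
    linarith
  have h2 : f ^ (p-1) ≤ m ^ (p-1) := Real.rpow_le_rpow hf.le hfm (by linarith)
  have h3 : p * f ^ (p-1) * (f - g) ≤ p * m ^ (p-1) * (f - g) := by
    have : 0 ≤ f - g := by linarith
    gcongr
  linarith

lemma pt2 {p f g m : ℝ} (hp : 1 < p) (hf : 0 ≤ f) (hfg : f ≤ g) :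
    f ^ p - g ^ p - m ^ (p-1) * (f - g) ≤ m ^ (p-1) * (g - f) := by
  have : f ^ p ≤ g ^ p := Real.rpow_le_rpow hf hfg (by linarith)
  linarith

lemma pt3 {p f g m δ : ℝ} (hp : 1 < p) (hf : 0 ≤ f) (hm : 0 < m) (hfg : f ≤ g) (hδ : 0 < δ) :
    f ^ p - g ^ p - m ^ (p-1) * (f - g) ≤ (p - 1) * m ^ (p-1) * (2 * Real.log (1/δ) * (g - f) + δ * √m * √g) := by
  have hp1 : 0 < p - 1 := by linarith
  have hmp : 0 < m ^ (p-1) := rpow_pos_of_pos hm _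
  rcases (hf.trans hfg).eq_or_lt with h0 | hg
  · have : f = 0 := by linarith
    subst this; rw [← h0]; simp
  have a1 : g ^ p = g ^ (p-1) * g := by rw [← rpow_add_one hg.ne', sub_add_cancel]
  have a2 : f ^ p ≤ g ^ (p-1) * f := by
    rcases hf.eq_or_lt with h0 | hf
    · rw [← h0, zero_rpow (by linarith)]; simp
    · have : f ^ p = f ^ (p-1) * f := by rw [← rpow_add_one hf.ne', sub_add_cancel]
      rw [this]
      gcongr
  have a3 : m ^ (p-1) - g ^ (p-1) ≤ (p-1) * m ^ (p-1) * Real.log (m / g) := by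
    have e : g ^ (p-1) = m ^ (p-1) * Real.exp (-(p-1) * Real.log (m/g)) := by
      rw [Real.rpow_def_of_pos hg, Real.rpow_def_of_pos hm, ← Real.exp_add, Real.log_div hm.ne' hg.ne']
      congr 1; ring
    have := Real.add_one_le_exp (-(p-1) * Real.log (m/g))
    rw [e]
    nlinarith
  have a4 : Real.log (m / g) ≤ 2 * Real.log (1/δ) + δ * √(m/g) := by
    have hs : 0 < √(m/g) := Real.sqrt_pos.2 (by positivity)
    have e : Real.log (m / g) = 2 * Real.log (1/δ) + 2 * Real.log (δ * √(m/g)) := by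
      rw [Real.log_mul hδ.ne' hs.ne', one_div, Real.log_inv, Real.log_sqrt (by positivity)]; ring
    have h1 : Real.log (δ * √(m/g)) ≤ δ * √(m/g) / 2 := by
      have := Real.log_le_sub_one_of_pos (x := δ * √(m/g) / 2) (by positivity)
      rw [Real.log_div (by positivity) (by norm_num)] at this
      have := Real.log_two_lt_d9
      linarith
    rw [e]; linarith
  have a5 : (g - f) * √(m/g) ≤ √m * √g := by
    calc (g - f) * √(m/g) ≤ g * √(m/g) := by gcongr; linarith
      _ = _ := by
        rw [Real.sqrt_div hm.le]
        have : 0 < √g := Real.sqrt_pos.2 hg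
        nth_rewrite 1 [← Real.mul_self_sqrt hg.le]
        field_simp
  have hgf : 0 ≤ g - f := by linarith
  calc f ^ p - g ^ p - m ^ (p-1) * (f - g) ≤ (g - f) * (m ^ (p-1) - g ^ (p-1)) := by rw [a1]; nlinarith
    _ ≤ (g - f) * ((p-1) * m ^ (p-1) * (2 * Real.log (1/δ) + δ * √(m/g))) := by
      gcongr
      exact a3.trans (by gcongr)
    _ = (p-1) * m ^ (p-1) * (2 * Real.log (1/δ) * (g - f) + δ * ((g - f) * √(m/g))) := by ring
    _ ≤ (p-1) * m ^ (p-1) * (2 * Real.log (1/δ) * (g - f) + δ * (√m * √g)) := by gcongr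
    _ = _ := by ring

lemma posneg {f g : ℝ → ℝ} (hf : GoodF f) (hg : GoodF g) :
    ∫ v, max (g v - f v) 0 = ∫ v, max (f v - g v) 0 := by
  have h1 : Integrable (fun v => max (f v - g v) 0) := (hf.int.sub hg.int).pos_part
  have h2 : Integrable (fun v => max (g v - f v) 0) := (hg.int.sub hf.int).pos_part
  have h3 : ∫ v, (max (f v - g v) 0 - max (g v - f v) 0) = ∫ v, (f v - g v) := by
    congr 1; funext v
    rcases le_total (f v) (g v) with h | h
    · rw [max_eq_right (by linarith), max_eq_left (by linarith)]; ring
    · rw [max_eq_left (by linarith), max_eq_right (by linarith)]; ring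
  rw [integral_sub h1 h2, integral_sub hf.int hg.int, hf.one, hg.one] at h3
  linarith

lemma ent1 {f g : ℝ → ℝ} (hf : GoodF f) (hg : GoodF g) {p ε : ℝ} (hp : 1 < p)
    (hε : ∫ v, max (f v - g v) 0 ≤ ε) :
    (∫ v, f v ^ p) - p * f 0 ^ (p-1) * ε ≤ ∫ v, g v ^ p := by
  have h1 : Integrable (fun v => max (f v - g v) 0) := (hf.int.sub hg.int).pos_part
  have h2 : Integrable (fun v => max (g v - f v) 0) := (hg.int.sub hf.int).pos_part
  set M := f 0 ^ (p-1)
  have hM : 0 ≤ M := rpow_nonneg (hf.lc.1 _) _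
  have hfp := hf.pow_int hp.le
  have hgp := hg.pow_int hp.le
  have i0 : Integrable (fun v => f v - g v) := hf.int.sub hg.int
  have i1 : Integrable (fun v => f v ^ p - g v ^ p) := hfp.sub hgp
  have i2 : Integrable (fun v => M * (f v - g v)) := i0.const_mul M
  have i3 : Integrable (fun v => f v ^ p - g v ^ p - M * (f v - g v)) := i1.sub i2
  have j1 : Integrable (fun v => (p-1) * M * max (f v - g v) 0) := h1.const_mul _
  have j2 : Integrable (fun v => M * max (g v - f v) 0) := h2.const_mul _
  have j3 : Integrable (fun v => (p-1) * M * max (f v - g v) 0 + M * max (g v - f v) 0) := j1.add j2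
  have key : ∫ v, (f v ^ p - g v ^ p - M * (f v - g v)) ≤ ∫ v, ((p-1) * M * max (f v - g v) 0 + M * max (g v - f v) 0) := by
    apply integral_mono i3 j3
    intro v
    dsimp only
    rcases le_total (f v) (g v) with h | h
    · rw [max_eq_right (by linarith), max_eq_left (by linarith)]
      have := pt2 (m := f 0) hp (hf.lc.1 v) h
      linarith
    · rw [max_eq_left (by linarith), max_eq_right (by linarith)]
      have := pt1 hp (hf.lc.1 v) (hf.le_zero v) (hg.lc.1 v) h
      linarith
  rw [integral_sub i1 i2, integral_sub hfp hgp, integral_const_mul,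
    integral_sub hf.int hg.int, hf.one, hg.one, integral_add j1 j2, integral_const_mul,
    integral_const_mul, posneg hf hg] at key
  have : p * M * ∫ v, max (f v - g v) 0 ≤ p * M * ε := by gcongr
  linarith

lemma ent2 {f g : ℝ → ℝ} (hf : GoodF f) (hg : GoodF g) {p ε δ : ℝ} (hp : 1 < p) (hδ : 0 < δ) (hδ1 : δ ≤ 1)
    (hε : ∫ v, max (f v - g v) 0 ≤ ε) :
    (∫ v, f v ^ p) - (p - 1) * f 0 ^ (p-1) * (ε * (1 + 2 * Real.log (1/δ)) + 2 * δ * (√(f 0) / √(g 0))) ≤ ∫ v, g v ^ p := by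
  have h1 : Integrable (fun v => max (f v - g v) 0) := (hf.int.sub hg.int).pos_part
  have h2 : Integrable (fun v => max (g v - f v) 0) := (hg.int.sub hf.int).pos_part
  set M := f 0 ^ (p-1)
  have hM : 0 ≤ M := rpow_nonneg (hf.lc.1 _) _
  have hp1 : 0 < p - 1 := by linarith
  have hfp := hf.pow_int hp.le
  have hgp := hg.pow_int hp.le
  set L := Real.log (1/δ)
  have hL : 0 ≤ L := Real.log_nonneg (by rw [le_div_iff₀ hδ]; linarith)
  have hsi := hg.sqrt_int
  have i0 : Integrable (fun v => f v - g v) := hf.int.sub hg.int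
  have i1 : Integrable (fun v => f v ^ p - g v ^ p) := hfp.sub hgp
  have i2 : Integrable (fun v => M * (f v - g v)) := i0.const_mul M
  have i3 : Integrable (fun v => f v ^ p - g v ^ p - M * (f v - g v)) := i1.sub i2
  have j1 : Integrable (fun v => 2 * L * max (g v - f v) 0) := h2.const_mul _
  have j2 : Integrable (fun v => δ * √(f 0) * √(g v)) := hsi.const_mul _
  have j3 : Integrable (fun v => 2 * L * max (g v - f v) 0 + δ * √(f 0) * √(g v)) := j1.add j2
  have j4 : Integrable (fun v => max (f v - g v) 0 + (2 * L * max (g v - f v) 0 + δ * √(f 0) * √(g v))) := h1.add j3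
  have key : ∫ v, (f v ^ p - g v ^ p - M * (f v - g v)) ≤
      ∫ v, ((p-1) * M * (max (f v - g v) 0 + (2 * L * max (g v - f v) 0 + δ * √(f 0) * √(g v)))) := by
    apply integral_mono i3 (j4.const_mul _)
    intro v
    dsimp only
    rcases le_total (f v) (g v) with h | h
    · rw [max_eq_right (by linarith), max_eq_left (by linarith)]
      have := pt3 (m := f 0) hp (hf.lc.1 v) hf.zero_pos h hδ
      simp only [zero_add]
      exact this
    · rw [max_eq_left (by linarith), max_eq_right (by linarith)]
      have := pt1 hp (hf.lc.1 v) (hf.le_zero v) (hg.lc.1 v) h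
      refine this.trans ?_
      apply mul_le_mul_of_nonneg_left _ (by positivity)
      have : 0 ≤ δ * √(f 0) * √(g v) := by positivity
      linarith
  rw [integral_sub i1 i2, integral_sub hfp hgp, integral_const_mul,
    integral_sub hf.int hg.int, hf.one, hg.one, integral_const_mul, integral_add h1 j3,
    integral_add j1 j2, integral_const_mul,
    integral_const_mul, posneg hf hg] at key
  set E := ∫ v, max (f v - g v) 0
  have hs := hg.int_sqrt_le
  have : (p-1) * M * (E + (2 * L * E + δ * √(f 0) * ∫ v, √(g v))) ≤ (p-1) * M * (ε + (2 * L * ε + δ * √(f 0) * (2 / √(g 0)))) := by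
    gcongr
  have e : (p - 1) * M * (ε * (1 + 2 * L) + 2 * δ * (√(f 0) / √(g 0))) = (p-1) * M * (ε + (2 * L * ε + δ * √(f 0) * (2 / √(g 0)))) := by ring
  rw [e]
  linarith

lemma lineI_zero (w : ℝ × ℝ → ℝ) : lineI w 0 = mgW w 0 := by simp [lineI_eq, mgW]

lemma lineI_shear (w : ℝ × ℝ → ℝ) (c c' : ℝ) : lineI (shearW c w) c' = lineI w (c' + c) := by
  simp only [lineI_eq, shearW, add_mul]

lemma mg_swap_shear (w : ℝ × ℝ → ℝ) (c v : ℝ) : mgW (swapW (shearW c w)) v = mgW (swapW w) v := by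
  simp only [mgW, swapW, shearW]
  exact integral_add_right_eq_self (fun y => w (y, v)) (c * v)

lemma mg_g (w : ℝ × ℝ → ℝ) (c v : ℝ) (hc : 0 < 1 + c) :
    mgW (shearW (-(1 / (1 + c))) (swapW (shearW c w))) v = (1 + c) * mgW (shearW (-1) w) ((1 + c) * v) := by
  simp only [mgW, swapW, shearW]
  have e1 : (fun y : ℝ => w (y + c * (v + -(1 / (1 + c)) * y), v + -(1 / (1 + c)) * y))
      = fun y => (fun t => w ((1 + c) * v + -1 * (v - t), v - t)) ((1 / (1 + c)) * y) := by
    funext y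
    have : y + c * (v + -(1 / (1 + c)) * y) = (1 + c) * v + -1 * (v - 1 / (1 + c) * y) := by
      field_simp; ring
    simp only [this]
    congr 2; ring
  rw [e1, Measure.integral_comp_mul_left (fun t => w ((1 + c) * v + -1 * (v - t), v - t)) (1 / (1 + c)),
    integral_sub_left_eq_self (fun t => w ((1 + c) * v + -1 * t, t)) volume v]
  rw [abs_of_pos (by positivity)]
  simp

lemma mg_swapS (w : ℝ × ℝ → ℝ) (v : ℝ) : mgW (shearW (-1) (swapW w)) v = mgW (shearW (-1) w) v := by
  simp only [mgW, swapW, shearW]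
  rw [← integral_sub_left_eq_self (fun y => w (v + -1 * y, y)) volume v]
  congr 1; funext y; congr 2 <;> ring

lemma core {w : ℝ × ℝ → ℝ} (h : GoodW w) {p : ℝ} (hp : 1 < p)
    (hx : mgW (swapW w) 0 / mgW w 0 ≤ 1/4) :
    ∃ c, |c| ≤ 2 * (mgW (swapW w) 0 / mgW w 0) ∧
      ((∫ v, mgW (swapW w) v ^ p) - p * mgW (swapW w) 0 ^ (p-1) * (12 * (mgW (swapW w) 0 / mgW w 0) / (1 + c))
        ≤ (1 + c) ^ (p-1) * ∫ v, mgW (shearW (-1) w) v ^ p) ∧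
      ∀ δ, 0 < δ → δ ≤ 1 →
       (∫ v, mgW (swapW w) v ^ p) - (p-1) * mgW (swapW w) 0 ^ (p-1) *
        (12 * (mgW (swapW w) 0 / mgW w 0) / (1 + c) * (1 + 2 * log (1/δ)) +
          2 * δ * (√(mgW (swapW w) 0) / √((1 + c) * mgW (shearW (-1) w) 0)))
        ≤ (1 + c) ^ (p-1) * ∫ v, mgW (shearW (-1) w) v ^ p := by
  have hm := h.swap.mg.zero_pos
  have hn := h.mg.zero_pos
  set m := mgW (swapW w) 0 with hmdef
  set n := mgW w 0 with hndef
  obtain ⟨c, hmax, hc⟩ := h.exists_max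
  have hmh : horI w = m := rfl
  rw [hmh, lineI_zero] at hc
  have hc' : |c| ≤ 2 * (m / n) := by rw [← mul_div_assoc]; exact hc
  have hc2 : 0 < 1 + c := by
    have := abs_le.1 hc'
    linarith [this.1]
  have hW := h.shear c
  have hmax' : ∀ c', lineI (shearW c w) c' ≤ lineI (shearW c w) 0 := by
    intro c'; rw [lineI_shear, lineI_shear, zero_add]; exact hmax _
  have tv := hW.tv hmax' (k := 1 / (1 + c)) (by positivity)
  have e1 : mgW (swapW (shearW c w)) = mgW (swapW w) := by funext v; exact mg_swap_shear w c v
  have e2 : mgW (shearW (-(1 / (1 + c))) (swapW (shearW c w))) = fun v => (1 + c) * mgW (shearW (-1) w) ((1 + c) * v) := by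
    funext v; exact mg_g w c v hc2
  have e3 : horI (shearW c w) = m := mg_swap_shear w c 0
  rw [e1, e2, e3, lineI_shear, zero_add] at tv
  have hI : n ≤ lineI w c := by have := hmax 0; rwa [lineI_zero] at this
  have hε : ∫ v, max (mgW (swapW w) v - (1 + c) * mgW (shearW (-1) w) ((1 + c) * v)) 0 ≤ 12 * (m / n) / (1 + c) := by
    refine tv.trans ?_
    calc 1 / (1 + c) * (12 * m / lineI w c) ≤ 1 / (1 + c) * (12 * m / n) := by gcongr
      _ = _ := by ring
  have gf := h.swap.mg
  have gg := (h.shear (-1)).mg.rescale hc2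
  have e4 : ∫ v, ((1 + c) * mgW (shearW (-1) w) ((1 + c) * v)) ^ p = (1 + c) ^ (p-1) * ∫ v, mgW (shearW (-1) w) v ^ p := by
    have : ∀ v, ((1 + c) * mgW (shearW (-1) w) ((1 + c) * v)) ^ p = (1 + c) ^ p * (fun t => mgW (shearW (-1) w) t ^ p) ((1 + c) * v) := by
      intro v; rw [mul_rpow hc2.le ((h.shear (-1)).mg.lc.1 _)]
    simp only [this]
    rw [integral_const_mul, Measure.integral_comp_mul_left (fun t => mgW (shearW (-1) w) t ^ p), abs_of_pos (by positivity),
      rpow_sub_one hc2.ne']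
    simp only [smul_eq_mul]; ring
  refine ⟨c, hc', ?_, ?_⟩
  · have := ent1 gf gg hp hε
    rw [e4] at this
    exact this
  · intro δ h0 h1
    have := ent2 gf gg hp h0 h1 hε
    rw [e4, mul_zero] at this
    exact this

lemma bus_q {w : ℝ × ℝ → ℝ} (h : GoodW w) :
    1 / mgW (shearW (-1) w) 0 ≤ 1 / mgW w 0 + 1 / mgW (swapW w) 0 := by
  have := h.bus1 0 (-1)
  rw [lineI_zero] at this
  simpa [lineI, horI] using this

lemma ell_facts {p : ℝ} (hp : 1 < p) : 0 < log p / (p-1) ∧ log p / (p-1) ≤ 1 ∧ 1/p ≤ log p / (p-1) ∧ 2/(p+1) ≤ log p / (p-1) := by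
  have h1 : 0 < p - 1 := by linarith
  have h2 := log_pos hp
  have h3 := log_le_sub_one_of_pos (by linarith : 0 < p)
  have h4 := Real.le_log_one_add_of_nonneg h1.le
  rw [show 1 + (p - 1) = p by ring, show p - 1 + 2 = p + 1 by ring] at h4
  have h5 : 2/(p+1) ≤ log p / (p-1) := by
    rw [le_div_iff₀ h1]; calc _ = 2 * (p-1)/(p+1) := by ring
      _ ≤ _ := h4
  refine ⟨by positivity, ?_, ?_, h5⟩
  · rw [div_le_one h1]; linarith
  · refine le_trans ?_ h5
    rw [div_le_div_iff₀ (by linarith) (by linarith)]; linarith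

lemma K_bound {p : ℝ} (hp : 1 < p) :
    190.7 * p + 27.6 ≤ 2 * (exp 1 + 1) * (2 * p * exp 1 ^ (2:ℕ) + (4 * p + 1) * exp 1 + 1) := by
  have h1 := exp_one_gt_d9
  have h : (2.7182818283:ℝ) ≤ exp 1 := h1.le
  calc 190.7 * p + 27.6 ≤ 2 * (2.7182818283 + 1) * (2 * p * 2.7182818283 ^ (2:ℕ) + (4 * p + 1) * 2.7182818283 + 1) := by
        norm_num; linarith
    _ ≤ _ := by gcongr

lemma exp_gap {y : ℝ} (hy : 0 ≤ y) {z : ℝ} (hz : z ≤ 0.9 * y * exp (-(0.9 * y))) : exp (-(0.97 * y)) ≤ 1 - z := by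
  have h1 : exp (-(0.97*y)) = exp (-(0.9*y)) * exp (-(0.07*y)) := by rw [← exp_add]; congr 1; ring
  have h2 : exp (-(0.07*y)) ≤ 1 := by rw [exp_le_one_iff]; linarith
  have h3 : 0.9 * y + 1 ≤ exp (0.9*y) := add_one_le_exp _
  have h4 : exp (-(0.9*y)) * exp (0.9*y) = 1 := by rw [← exp_add]; simp
  have h5 := exp_pos (-(0.9*y))
  have h6 : exp (-(0.9*y)) * exp (-(0.07*y)) ≤ exp (-(0.9*y)) * 1 := by gcongr
  have h7 : exp (-(0.9*y)) * (0.9 * y + 1) ≤ exp (-(0.9*y)) * exp (0.9*y) := by gcongr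
  rw [h1]
  nlinarith

/-- case p ≥ 4/3 -/
lemma z1 {p ℓ K κ k σ ε : ℝ} (hp : 4/3 ≤ p) (hℓ : 0 < ℓ) (hK : 190.7 * p ≤ K) (hσ : 0 < σ) (hσ1 : σ ≤ 1)
    (hκ0 : 0 < κ) (hκ : κ ≤ exp 1) (hk0 : 0 < k) (hk : k ≤ p * exp (-(0.9 * (σ * ℓ * (p-1)))))
    (hε : ε ≤ 12.37 * κ * σ^2 * ℓ / K) :
    p * k * ε ≤ 0.9 * (σ * ℓ * (p-1)) * exp (-(0.9 * (σ * ℓ * (p-1)))) := by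
  set E := exp (-(0.9 * (σ * ℓ * (p-1)))) with hE
  have hE0 : 0 < E := exp_pos _
  have he := exp_one_lt_d9
  have hp0 : 0 < p := by linarith
  have hκ' : κ ≤ 2.7183 := by linarith
  have hK0 : 0 < K := by linarith
  have h1 : p * k * ε ≤ p * (p * E) * (12.37 * 2.7183 * σ^2 * ℓ / (190.7 * p)) := by
    calc p * k * ε ≤ p * k * (12.37 * κ * σ^2 * ℓ / K) := by gcongr
      _ ≤ p * (p * E) * (12.37 * 2.7183 * σ^2 * ℓ / (190.7 * p)) := by gcongr
  refine h1.trans ?_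
  have h2 : p * (p * E) * (12.37 * 2.7183 * σ^2 * ℓ / (190.7 * p)) = (12.37 * 2.7183 / 190.7) * (p * σ) * (σ * ℓ * E) := by
    field_simp
  have h3 : 0.9 * (σ * ℓ * (p-1)) * E = (0.9 * (p-1)) * (σ * ℓ * E) := by ring
  rw [h2, h3]
  have : p * σ ≤ p * 1 := by gcongr
  apply mul_le_mul_of_nonneg_right _ (by positivity)
  norm_num
  nlinarith

/-- case p < 4/3 -/
lemma z2 {p ℓ K κ k σ ε R : ℝ} (hp1 : 1 < p) (hp : p < 4/3) (hℓ : 6/7 ≤ ℓ) (hℓ1 : ℓ ≤ 1) (hK : 190.7 * p + 27.6 ≤ K)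
    (hσ : 0 < σ) (hσ1 : σ ≤ 1)
    (hκ0 : 0 < κ) (hκ : κ ≤ exp 1) (hκ' : κ ≤ exp (ℓ * (1 - 0.9 * σ))) (hk0 : 0 < k) (hk : k ≤ p * exp (-(0.9 * (σ * ℓ * (p-1)))))
    (hε : ε ≤ 12.37 * κ * σ^2 * ℓ / K) (hR0 : 0 ≤ R) (hR : R ≤ 1.02) :
    (p-1) * k * (ε * (1 + 2 * log (1/(σ/16))) + 2 * (σ/16) * R) ≤ 0.9 * (σ * ℓ * (p-1)) * exp (-(0.9 * (σ * ℓ * (p-1)))) := by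
  set E := exp (-(0.9 * (σ * ℓ * (p-1)))) with hE
  have hE0 : 0 < E := exp_pos _
  have he := exp_one_lt_d9
  have he0 := exp_pos 1
  have hp0 : 0 < p := by linarith
  have hp10 : 0 < p - 1 := by linarith
  have hl0 : 0 < ℓ := by linarith
  have hKp : 211 * p ≤ K := by linarith
  have hl : log (1/(σ/16)) = 4 * log 2 + log (1/σ) := by
    rw [show 1/(σ/16) = 16 * (1/σ) by field_simp, log_mul (by norm_num) (by positivity), show (16:ℝ) = 2^(4:ℕ) by norm_num, log_pow]
    norm_num
  have hlog2 := log_two_lt_d9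
  have hlog20 : 0 < log 2 := log_pos (by norm_num)
  have hls0 : 0 ≤ log (1/σ) := log_nonneg (by rw [le_div_iff₀ hσ]; linarith)
  -- kappa sigma log(1/sigma) ≤ 1
  have ha : κ * σ * log (1/σ) ≤ 1 := by
    have h1 : log (1/σ) ≤ (1/σ) * exp (-1) := by
      have h2 := add_one_le_exp (log (1/σ) - 1)
      rw [sub_add_cancel, sub_eq_add_neg, exp_add, exp_log (by positivity)] at h2
      exact h2
    calc κ * σ * log (1/σ) ≤ exp 1 * σ * ((1/σ) * exp (-1)) := by gcongr
      _ = exp 1 * exp (-1) * (σ * (1/σ)) := by ring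
      _ = 1 := by rw [← exp_add]; field_simp; simp
  have hb : 0.9 * (κ * σ * ℓ) ≤ 1 := by
    have h2 := add_one_le_exp (0.9 * σ * ℓ - 1)
    rw [sub_add_cancel] at h2
    calc 0.9 * (κ * σ * ℓ) = κ * (0.9 * σ * ℓ) := by ring
      _ ≤ exp (ℓ * (1 - 0.9 * σ)) * exp (0.9 * σ * ℓ - 1) := by gcongr
      _ = exp (ℓ - 1) := by rw [← exp_add]; congr 1; ring
      _ ≤ 1 := by rw [exp_le_one_iff]; linarith
  have hL0 : 0 ≤ 1 + 2 * log (1/(σ/16)) := by rw [hl]; positivity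
  have h1 : p * ε ≤ 12.37 / 211 * (κ * σ^2 * ℓ) := by
    calc p * ε ≤ p * (12.37 * κ * σ^2 * ℓ / K) := by gcongr
      _ ≤ p * (12.37 * κ * σ^2 * ℓ / (211 * p)) := by gcongr
      _ = _ := by field_simp
  have h2 : p * (ε * (1 + 2 * log (1/(σ/16)))) ≤ 12.37 / 211 * σ * (6.546/0.9 + 2) := by
    calc p * (ε * (1 + 2 * log (1/(σ/16)))) = (p * ε) * (1 + 2 * log (1/(σ/16))) := by ring
      _ ≤ 12.37 / 211 * (κ * σ^2 * ℓ) * (1 + 2 * log (1/(σ/16))) := by gcongr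
      _ = 12.37 / 211 * σ * ((κ * σ * ℓ) * (1 + 8 * log 2) + 2 * ((κ * σ * log (1/σ)) * ℓ)) := by rw [hl]; ring
      _ ≤ 12.37 / 211 * σ * ((1/0.9) * 6.546 + 2 * (1 * 1)) := by
          gcongr
          · rw [le_div_iff₀ (by norm_num)]; linarith
          · linarith
      _ = _ := by ring
  have h3 : p * (2 * (σ/16) * R) ≤ 4/3 * (2 * (σ/16) * 1.02) := by gcongr
  have h4 : p * (ε * (1 + 2 * log (1/(σ/16))) + 2 * (σ/16) * R) ≤ 0.9 * (σ * ℓ) := by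
    rw [mul_add]
    have h5 : σ * (6/7) ≤ σ * ℓ := by gcongr
    norm_num at h2 h3 ⊢
    linarith
  rcases le_total 0 (ε * (1 + 2 * log (1/(σ/16))) + 2 * (σ/16) * R) with hT | hT
  · calc (p-1) * k * (ε * (1 + 2 * log (1/(σ/16))) + 2 * (σ/16) * R)
        ≤ (p-1) * (p * E) * (ε * (1 + 2 * log (1/(σ/16))) + 2 * (σ/16) * R) := by gcongr
      _ = (p-1) * E * (p * (ε * (1 + 2 * log (1/(σ/16))) + 2 * (σ/16) * R)) := by ring
      _ ≤ (p-1) * E * (0.9 * (σ * ℓ)) := by gcongr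
      _ = _ := by ring
  · calc (p-1) * k * (ε * (1 + 2 * log (1/(σ/16))) + 2 * (σ/16) * R) ≤ 0 := mul_nonpos_of_nonneg_of_nonpos (by positivity) hT
      _ ≤ _ := by positivity

set_option maxHeartbeats 1000000 in
lemma key_num {p ℓ K a b s n m q σ : ℝ} (hp : 1 < p) (hℓ : ℓ = log p / (p-1)) (hK : 190.7 * p + 27.6 ≤ K)
    (ha : 0 < a) (hb : 0 < b) (hs : 0 < s) (hn : 0 < n) (hm : 0 < m) (hq : 0 < q)
    (hσ : 0 < σ) (hσ1 : σ ≤ 1) (ht : a = (σ^2 * ℓ / K) * (a + b))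
    (han : 1 ≤ a * n) (hbm : 1 ≤ b * m) (hbm' : b * m ≤ exp ℓ) (hsq : s * q ≤ exp ℓ)
    (hbus : 1/q ≤ 1/n + 1/m)
    (hcore : m / n ≤ 1/4 → ∃ c, |c| ≤ 2 * (m/n) ∧
      (1 - p * (b*m)^(p-1) * (12 * (m/n) / (1+c)) ≤ ((1+c) * b / s)^(p-1)) ∧
      ∀ δ, 0 < δ → δ ≤ 1 → 1 - (p-1) * (b*m)^(p-1) * (12 * (m/n)/(1+c) * (1 + 2 * log (1/δ)) + 2 * δ * (√m / √((1+c)*q)))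
        ≤ ((1+c) * b / s)^(p-1)) :
    s ≤ exp (σ * ℓ) * (a + b) := by
  obtain ⟨hl0, hl1, hl2, hl3⟩ := ell_facts hp
  rw [← hℓ] at hl0 hl1 hl2 hl3
  have he := exp_one_lt_d9
  have hp0 : 0 < p := by linarith
  have hp10 : 0 < p - 1 := by linarith
  have hK218 : 218 ≤ K := by linarith
  have hK0 : 0 < K := by linarith
  have hC : exp ℓ ≤ 2.7183 := by
    have : exp ℓ ≤ exp 1 := exp_le_exp.2 hl1
    linarith
  set t := σ^2 * ℓ / K with htdef
  have ht0 : 0 < t := by positivity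
  have hσ2 : σ^2 ≤ σ := by nlinarith
  have ht1 : t ≤ σ * ℓ / 218 := by rw [htdef]; gcongr
  have hsl : σ * ℓ ≤ 1 := by nlinarith
  have ht2 : t ≤ 1/218 := by linarith
  have hab : a * (1 - t) = t * b := by linarith
  have hab' : a = t * b / (1 - t) := by rw [eq_div_iff (by linarith)]; exact hab
  rcases le_or_gt (exp (ℓ * (1 - 0.9 * σ))) (b * m) with hcase | hcase
  · have h1 : s ≤ exp ℓ * (a + 1/m) := by
      have h2 : 1/n ≤ a := by rw [div_le_iff₀ hn]; exact han
      calc s = s * q * (1/q) := by field_simp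
        _ ≤ exp ℓ * (1/n + 1/m) := by gcongr
        _ ≤ _ := by gcongr
    have h3 : exp ℓ * (1/m) ≤ exp (0.9 * (σ * ℓ)) * b := by
      have : exp ℓ = exp (0.9 * (σ * ℓ)) * exp (ℓ * (1 - 0.9 * σ)) := by rw [← exp_add]; congr 1; ring
      rw [this, mul_assoc]
      gcongr
      rw [mul_one_div, div_le_iff₀ hm]; exact hcase
    have h4 : exp ℓ * t + exp (0.9 * (σ * ℓ)) ≤ exp (σ * ℓ) := by
      have e1 : exp (σ * ℓ) = exp (0.9 * (σ * ℓ)) * exp (0.1 * (σ * ℓ)) := by rw [← exp_add]; congr 1; ring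
      have e2 : 0.1 * (σ * ℓ) + 1 ≤ exp (0.1 * (σ * ℓ)) := add_one_le_exp _
      have e3 : 1 ≤ exp (0.9 * (σ * ℓ)) := one_le_exp (by positivity)
      have e4 : exp ℓ * t ≤ 2.7183 * (σ * ℓ / 218) := by gcongr
      have e5 : 0 < σ * ℓ := by positivity
      rw [e1]
      nlinarith [mul_le_mul_of_nonneg_left e2 (exp_pos (0.9 * (σ * ℓ))).le, mul_nonneg (sub_nonneg.2 e3) e5.le]
    calc s ≤ exp ℓ * (a + 1/m) := h1
      _ = exp ℓ * a + exp ℓ * (1/m) := by ring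
      _ ≤ exp ℓ * (t * (a + b)) + exp (0.9 * (σ * ℓ)) * (a + b) := by
          apply add_le_add
          · rw [← ht]
          · refine h3.trans ?_
            gcongr; linarith
      _ = (exp ℓ * t + exp (0.9 * (σ * ℓ))) * (a + b) := by ring
      _ ≤ _ := by gcongr
  · set κ := b * m with hκ
    have hκ0 : 0 < κ := by positivity
    have hx1 : m / n ≤ κ * (t / (1 - t)) := by
      have h2 : 1/n ≤ a := by rw [div_le_iff₀ hn]; exact han
      calc m / n = m * (1/n) := by ring
        _ ≤ m * a := by gcongr
        _ = κ * (t / (1-t)) := by rw [hab', hκ]; ring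
    have hx0 : 0 < m / n := by positivity
    have h1t : t / (1 - t) ≤ 1.0047 * t := by
      rw [div_le_iff₀ (by linarith)]; nlinarith
    have hx2 : m / n ≤ 1.0047 * (κ * t) := by
      calc _ ≤ _ := hx1
        _ ≤ κ * (1.0047 * t) := by gcongr
        _ = _ := by ring
    have hκ27 : κ ≤ 2.7183 := by linarith
    have hx3 : m / n ≤ 0.01254 * (σ * ℓ) := by
      have : κ * t ≤ 2.7183 * (σ * ℓ / 218) := by gcongr
      have : 0 < σ * ℓ := by positivity
      linarith
    have hx4 : m / n ≤ 0.01254 := by linarith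
    obtain ⟨c, hc, H1, H2⟩ := hcore (by linarith)
    set x := m / n with hx
    obtain ⟨hc1, hc2⟩ := abs_le.1 hc
    have hc0 : 0.9749 ≤ 1 + c := by linarith
    have hcp : 0 < 1 + c := by linarith
    have hce : 1 + c ≤ exp (0.03 * (σ * ℓ)) := by
      have h1 := add_one_le_exp c
      have h2 : exp c ≤ exp (0.03 * (σ * ℓ)) := exp_le_exp.2 (by have : 0 < σ * ℓ := by positivity
                                                                 linarith)
      linarith
    have hε : 12 * x / (1 + c) ≤ 12.37 * κ * σ^2 * ℓ / K := by
      have e1 : 12.37 * κ * σ^2 * ℓ / K = 12.37 * (κ * t) := by rw [htdef]; ring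
      rw [e1, div_le_iff₀ hcp]
      have e2 : 0 < κ * t := by positivity
      have e3 : 12.37 * (κ * t) * 0.9749 ≤ 12.37 * (κ * t) * (1 + c) := by gcongr
      linarith
    have hk : κ^(p-1) ≤ p * exp (-(0.9 * (σ * ℓ * (p-1)))) := by
      calc κ^(p-1) ≤ (exp (ℓ * (1 - 0.9 * σ)))^(p-1) := rpow_le_rpow hκ0.le hcase.le hp10.le
        _ = exp (log p + -(0.9 * (σ * ℓ * (p-1)))) := by
            rw [← exp_mul]; congr 1
            have : log p = ℓ * (p-1) := by rw [hℓ]; field_simp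
            rw [this]; ring
        _ = _ := by rw [exp_add, exp_log hp0]
    have hk0 : 0 < κ^(p-1) := by positivity
    have hκe : κ ≤ exp 1 := hbm'.trans (exp_le_exp.2 hl1)
    have hfin : exp (-(0.97 * (σ * ℓ * (p-1)))) ≤ ((1+c) * b / s)^(p-1) := by
      have hy : 0 ≤ σ * ℓ * (p-1) := by positivity
      rcases le_or_gt (4/3) p with h43 | h43
      · exact (exp_gap hy (z1 h43 hl0 (by linarith) hσ hσ1 hκ0 hκe hk0 hk hε)).trans H1
      · have hl67 : 6/7 ≤ ℓ := by
          refine le_trans ?_ hl3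
          rw [div_le_div_iff₀ (by norm_num) (by linarith)]; linarith
        have hR : √m / √((1+c)*q) ≤ 1.02 := by
          rw [← sqrt_div hm.le]
          apply sqrt_le_iff.2 ⟨by norm_num, ?_⟩
          rw [div_le_iff₀ (by positivity)]
          have h1 : m / q ≤ x + 1 := by
            calc m / q = m * (1/q) := by ring
              _ ≤ m * (1/n + 1/m) := by gcongr
              _ = x + 1 := by rw [hx]; field_simp
          rw [div_le_iff₀ hq] at h1
          have : (x+1) * q ≤ 1.02^2 * ((1+c)*q) := by
            rw [← mul_assoc]; gcongr; norm_num; linarith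
          linarith
        exact (exp_gap hy (z2 hp h43 hl67 hl1 hK hσ hσ1 hκ0 hκe hcase.le hk0 hk hε (by positivity) hR)).trans
          (H2 (σ/16) (by positivity) (by linarith))
    have h5 : exp (-(0.97 * (σ * ℓ))) ≤ (1+c) * b / s := by
      rw [show -(0.97 * (σ * ℓ * (p-1))) = (-(0.97 * (σ * ℓ))) * (p-1) by ring, exp_mul] at hfin
      exact (rpow_le_rpow_iff (exp_pos _).le (by positivity) hp10).1 hfin
    rw [le_div_iff₀ hs] at h5
    calc s = exp (0.97 * (σ * ℓ)) * (exp (-(0.97 * (σ * ℓ))) * s) := by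
          rw [← mul_assoc, ← exp_add]; simp
      _ ≤ exp (0.97 * (σ * ℓ)) * ((1 + c) * b) := by gcongr
      _ ≤ exp (0.97 * (σ * ℓ)) * (exp (0.03 * (σ * ℓ)) * b) := by gcongr
      _ = exp (σ * ℓ) * b := by rw [← mul_assoc, ← exp_add]; congr 2; ring
      _ ≤ _ := by gcongr; linarith

lemma theta_facts {p : ℝ} (hp : 1 < p) : 0 < thetaP p ∧ thetaP p < 1/4 ∧
    thetaP p = log p / (p-1) / (2 * (exp 1 + 1) * (2 * p * exp 1 ^ (2:ℕ) + (4 * p + 1) * exp 1 + 1)) ∧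
    thetaP p < (log p / (p-1)) ^ 2 / 4 := by
  obtain ⟨hl0, hl1, hl2, hl3⟩ := ell_facts hp
  have hK := K_bound hp
  have e : thetaP p = log p / (p-1) / (2 * (exp 1 + 1) * (2 * p * exp 1 ^ (2:ℕ) + (4 * p + 1) * exp 1 + 1)) := by
    rw [thetaP]; ring
  set K := 2 * (exp 1 + 1) * (2 * p * exp 1 ^ (2:ℕ) + (4 * p + 1) * exp 1 + 1)
  set ℓ := log p / (p-1)
  have hK0 : 0 < K := by linarith
  rw [e]
  refine ⟨by positivity, ?_, rfl, ?_⟩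
  · rw [div_lt_iff₀ hK0]; linarith
  · rw [div_lt_iff₀ hK0]
    rw [div_le_iff₀ (by linarith)] at hl2
    have h1 : 4 * ℓ < ℓ * (ℓ * K) := by
      have : ℓ * (190.7 * p) ≤ ℓ * K := by gcongr; linarith
      have h4 : 4 < ℓ * K := by linarith
      nlinarith
    linarith

lemma alpha_half {ℓ θ α : ℝ} (hℓ : 0 < ℓ) (hθ : 0 < θ) (hθ1 : θ < 1/4) (h4 : θ < ℓ^2/4)
    (hsol : exp (ℓ * α) = θ ^ α + (1 - θ) ^ α) : α < 1/2 := by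
  by_contra hcon
  push Not at hcon
  have h1 : ℓ * α + 1 ≤ exp (ℓ * α) := add_one_le_exp _
  have h2 : θ ^ α ≤ θ ^ (1/2:ℝ) := rpow_le_rpow_of_exponent_ge hθ (by linarith) hcon
  have h3 : (1 - θ) ^ α ≤ 1 := rpow_le_one (by linarith) (by linarith) (by linarith)
  rw [← sqrt_eq_rpow] at h2
  have h5 : √θ < ℓ / 2 := by
    rw [sqrt_lt' (by positivity)]; linarith
  have h6 : ℓ * (1/2) ≤ ℓ * α := by gcongr
  linarith

lemma mid_case {ℓ θ α t : ℝ} (hα : 0 < α) (hα1 : α < 1/2) (hθ : 0 < θ) (hθ1 : θ < 1/4)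
    (hsol : exp (ℓ * α) = θ ^ α + (1 - θ) ^ α) (h1 : θ ≤ t) (h2 : t ≤ 1 - θ) :
    exp (ℓ * α) ≤ t ^ α + (1 - t) ^ α := by
  have hc := Real.concaveOn_rpow hα.le (by linarith : α ≤ 1)
  set u := (1 - θ - t) / (1 - 2 * θ) with hu
  have hd : 0 < 1 - 2 * θ := by linarith
  have hu0 : 0 ≤ u := div_nonneg (by linarith) hd.le
  have hu1 : 0 ≤ 1 - u := by
    rw [sub_nonneg, hu, div_le_one hd]; linarith
  have m1 : θ ∈ Set.Ici (0:ℝ) := hθ.le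
  have m2 : 1 - θ ∈ Set.Ici (0:ℝ) := by simp; linarith
  have i1 := hc.2 m1 m2 hu0 hu1 (by ring)
  have i2 := hc.2 m1 m2 hu1 hu0 (by ring)
  simp only [smul_eq_mul] at i1 i2
  have huu : u * (1 - 2 * θ) = 1 - θ - t := by rw [hu, div_mul_cancel₀ _ hd.ne']
  have e1 : u * θ + (1 - u) * (1 - θ) = t := by linarith
  have e2 : (1 - u) * θ + u * (1 - θ) = 1 - t := by linarith
  rw [e1] at i1
  rw [e2] at i2
  rw [hsol]
  linarith

lemma small_case {ℓ θ α σ : ℝ} (hα : 0 < α) (hα1 : α < 1/2) (hθ : 0 < θ) (hθ1 : θ < 1/4)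
    (hsol : exp (ℓ * α) = θ ^ α + (1 - θ) ^ α) (hσ : 0 < σ) (hσ1 : σ ≤ 1) :
    exp (σ * ℓ * α) ≤ (σ^2 * θ) ^ α + (1 - σ^2 * θ) ^ α := by
  have hc := Real.concaveOn_rpow hα.le (by linarith : α ≤ 1)
  have hσ2 : σ^2 ≤ 1 := by nlinarith
  have hσ3 : σ^2 ≤ σ := by nlinarith
  have m1 : (1:ℝ) ∈ Set.Ici (0:ℝ) := by simp
  have m2 : 1 - θ ∈ Set.Ici (0:ℝ) := by simp; linarith
  have i1 := hc.2 m1 m2 (by linarith : 0 ≤ 1 - σ^2) (by positivity : 0 ≤ σ^2) (by ring)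
  simp only [smul_eq_mul, one_rpow] at i1
  rw [show (1 - σ^2) * 1 + σ^2 * (1 - θ) = 1 - σ^2 * θ by ring] at i1
  have h3 : (1 - θ) ^ α ≤ 1 := rpow_le_one (by linarith) (by linarith) (by linarith)
  have i2 : σ * θ ^ α ≤ (σ^2 * θ) ^ α := by
    rw [mul_rpow (by positivity) hθ.le]
    gcongr
    rw [← rpow_natCast, ← rpow_mul hσ.le]
    calc σ = σ ^ (1:ℝ) := by simp
      _ ≤ _ := rpow_le_rpow_of_exponent_ge hσ hσ1 (by push_cast; linarith)
  have i3 := rpow_one_add_le_one_add_mul_self (s := exp (ℓ * α) - 1) (by linarith [exp_pos (ℓ * α)]) hσ.le hσ1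
  rw [add_sub_cancel, ← exp_mul, show ℓ * α * σ = σ * ℓ * α by ring] at i3
  have i4 : σ^2 * (1 - (1-θ)^α) ≤ σ * (1 - (1-θ)^α) := by
    apply mul_le_mul_of_nonneg_right hσ3; linarith
  rw [hsol] at i3
  linarith

lemma ent_pow {F : ℝ → ℝ} (h : GoodF F) {p : ℝ} (hp : 1 < p) :
    0 < ∫ x, F x ^ p ∧ (exp (renyiEntropy1 p F)) ^ (p-1) = 1 / ∫ x, F x ^ p := by
  have hp10 : 0 < p - 1 := by linarith
  have h1 := h.le_int_pow hp.le
  have h0 : 0 < F 0 ^ (p-1) := rpow_pos_of_pos h.zero_pos _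
  have hA : 0 < ∫ x, F x ^ p := by
    by_contra hc
    push Not at hc
    nlinarith
  refine ⟨hA, ?_⟩
  rw [renyiEntropy1, ← exp_mul, show 1 / (1 - p) * log (∫ x, F x ^ p) * (p-1) = - log (∫ x, F x ^ p) by
    rw [show 1 - p = -(p-1) by ring]; field_simp, exp_neg, exp_log hA, one_div]

lemma ent_bounds {F : ℝ → ℝ} (h : GoodF F) {p : ℝ} (hp : 1 < p) :
    1 ≤ exp (renyiEntropy1 p F) * F 0 ∧ exp (renyiEntropy1 p F) * F 0 ≤ exp (log p / (p-1)) := by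
  have hp10 : 0 < p - 1 := by linarith
  obtain ⟨hA, e⟩ := ent_pow h hp
  have hF := h.zero_pos
  have e2 : (exp (renyiEntropy1 p F) * F 0) ^ (p-1) = F 0 ^ (p-1) / ∫ x, F x ^ p := by
    rw [mul_rpow (exp_pos _).le hF.le, e]; ring
  constructor
  · rw [← rpow_le_rpow_iff zero_le_one (by positivity) hp10, e2, one_rpow, le_div_iff₀ hA, one_mul]
    exact h.int_pow_le hp.le
  · rw [← rpow_le_rpow_iff (by positivity) (exp_pos _).le hp10, e2, ← exp_mul, div_mul_cancel₀ _ hp10.ne', exp_log (by linarith),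
      div_le_iff₀ hA]
    exact h.le_int_pow hp.le

lemma small_main {w : ℝ × ℝ → ℝ} (h : GoodW w) {p α : ℝ} (hp : 1 < p) (hα : 0 < α) (hα1 : α < 1/2)
    (hsol : exp (log p / (p-1) * α) = thetaP p ^ α + (1 - thetaP p) ^ α)
    (ht : exp (renyiEntropy1 p (mgW w)) / (exp (renyiEntropy1 p (mgW w)) + exp (renyiEntropy1 p (mgW (swapW w)))) ≤ thetaP p) :
    exp (renyiEntropy1 p (mgW (shearW (-1) w))) ^ α ≤
      exp (renyiEntropy1 p (mgW w)) ^ α + exp (renyiEntropy1 p (mgW (swapW w))) ^ α := by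
  have gX := h.mg
  have gY := h.swap.mg
  have gS := (h.shear (-1)).mg
  obtain ⟨bX1, bX2⟩ := ent_bounds gX hp
  obtain ⟨bY1, bY2⟩ := ent_bounds gY hp
  obtain ⟨bS1, bS2⟩ := ent_bounds gS hp
  obtain ⟨pB, eB⟩ := ent_pow gY hp
  obtain ⟨pS, eS⟩ := ent_pow gS hp
  have hco := core h hp
  have hbus := bus_q h
  have hm := gY.zero_pos
  have hn := gX.zero_pos
  have hq := gS.zero_pos
  obtain ⟨th0, th1, th2, th3⟩ := theta_facts hp
  have hK := K_bound hp
  have hp10 : 0 < p - 1 := by linarith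
  set a := exp (renyiEntropy1 p (mgW w)) with ha
  set b := exp (renyiEntropy1 p (mgW (swapW w))) with hb
  set s := exp (renyiEntropy1 p (mgW (shearW (-1) w))) with hs
  have ha0 : 0 < a := exp_pos _
  have hb0 : 0 < b := exp_pos _
  have hs0 : 0 < s := exp_pos _
  set K := 2 * (exp 1 + 1) * (2 * p * exp 1 ^ (2:ℕ) + (4 * p + 1) * exp 1 + 1) with hKd
  set θ := thetaP p with hθ
  set ℓ := log p / (p-1) with hℓ
  set B := ∫ v, mgW (swapW w) v ^ p
  set S := ∫ v, mgW (shearW (-1) w) v ^ p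
  set m := mgW (swapW w) 0
  set n := mgW w 0
  set q := mgW (shearW (-1) w) 0
  set t := a / (a + b) with htd
  have ht0 : 0 < t := by positivity
  set σ := √(t / θ) with hσ
  have hσ0 : 0 < σ := sqrt_pos.2 (by positivity)
  have hσ1 : σ ≤ 1 := by rw [hσ, sqrt_le_one, div_le_one th0]; exact ht
  have hσt : σ^2 * θ = t := by rw [hσ, sq_sqrt (by positivity)]; field_simp
  have hta : a = (σ^2 * ℓ / K) * (a + b) := by
    have : σ^2 * ℓ / K = t := by rw [← hσt, th2]; ring
    rw [this, htd]; field_simp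
  have hkey : s ≤ exp (σ * ℓ) * (a + b) := by
    refine key_num hp hℓ hK ha0 hb0 hs0 hn hm hq hσ0 hσ1 hta bX1 bY1 bY2 bS2 hbus ?_
    intro hx
    obtain ⟨c, hc, H1, H2⟩ := hco hx
    have hcp : 0 < 1 + c := by
      have := (abs_le.1 hc).1
      linarith
    have eb : (b * m) ^ (p-1) = m ^ (p-1) / B := by rw [mul_rpow hb0.le hm.le, eB]; ring
    have es : ((1 + c) * b / s) ^ (p-1) = (1 + c) ^ (p-1) * S / B := by
      rw [div_rpow (by positivity) hs0.le, mul_rpow hcp.le hb0.le, eB, eS]; field_simp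
    refine ⟨c, hc, ?_, ?_⟩
    · rw [eb, es, le_div_iff₀ pB]
      refine le_trans (le_of_eq ?_) H1
      field_simp
    · intro δ h0 h1
      rw [eb, es, le_div_iff₀ pB]
      refine le_trans (le_of_eq ?_) (H2 δ h0 h1)
      rw [sub_mul, one_mul]
      congr 1
      field_simp
  have h2 := small_case hα hα1 th0 th1 hsol hσ0 hσ1
  rw [hσt] at h2
  have h1t : 1 - t = b / (a + b) := by rw [htd]; field_simp; ring
  calc s ^ α ≤ (exp (σ * ℓ) * (a + b)) ^ α := rpow_le_rpow hs0.le hkey hα.le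
    _ = exp (σ * ℓ * α) * (a + b) ^ α := by rw [mul_rpow (exp_pos _).le (by positivity), ← exp_mul]
    _ ≤ (t ^ α + (1 - t) ^ α) * (a + b) ^ α := by gcongr
    _ = a ^ α + b ^ α := by
        rw [h1t, htd, div_rpow ha0.le (by positivity), div_rpow hb0.le (by positivity)]
        have : (a + b) ^ α ≠ 0 := (rpow_pos_of_pos (by positivity) _).ne'
        field_simp

lemma good_main {w : ℝ × ℝ → ℝ} (h : GoodW w) {p α : ℝ} (hp : 1 < p) (hα : 0 < α)
    (hsol : p ^ (α / (p-1)) = thetaP p ^ α + (1 - thetaP p) ^ α) :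
    exp (renyiEntropy1 p (mgW (shearW (-1) w))) ^ α ≤
      exp (renyiEntropy1 p (mgW w)) ^ α + exp (renyiEntropy1 p (mgW (swapW w))) ^ α := by
  obtain ⟨th0, th1, th2, th3⟩ := theta_facts hp
  obtain ⟨hl0, hl1, hl2, hl3⟩ := ell_facts hp
  have hsol' : exp (log p / (p-1) * α) = thetaP p ^ α + (1 - thetaP p) ^ α := by
    rw [← hsol, rpow_def_of_pos (by linarith)]; congr 1; ring
  have hα1 := alpha_half hl0 th0 th1 th3 hsol'
  rcases le_total (exp (renyiEntropy1 p (mgW w)) / (exp (renyiEntropy1 p (mgW w)) + exp (renyiEntropy1 p (mgW (swapW w))))) (thetaP p) with ht | ht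
  · exact small_main h hp hα hα1 hsol' ht
  rcases le_total (exp (renyiEntropy1 p (mgW (swapW w))) / (exp (renyiEntropy1 p (mgW (swapW w))) + exp (renyiEntropy1 p (mgW w)))) (thetaP p) with ht' | ht'
  · have := small_main h.swap hp hα hα1 hsol' ht'
    have e : mgW (shearW (-1) (swapW w)) = mgW (shearW (-1) w) := by funext v; exact mg_swapS w v
    rw [e] at this
    rw [add_comm]; exact this
  have gX := h.mg
  have gY := h.swap.mg
  have gS := (h.shear (-1)).mg
  obtain ⟨bX1, bX2⟩ := ent_bounds gX hp
  obtain ⟨bY1, bY2⟩ := ent_bounds gY hp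
  obtain ⟨bS1, bS2⟩ := ent_bounds gS hp
  have hbus := bus_q h
  have hm := gY.zero_pos
  have hn := gX.zero_pos
  have hq := gS.zero_pos
  set a := exp (renyiEntropy1 p (mgW w)) with ha
  set b := exp (renyiEntropy1 p (mgW (swapW w))) with hb
  set s := exp (renyiEntropy1 p (mgW (shearW (-1) w))) with hs
  have ha0 : 0 < a := exp_pos _
  have hb0 : 0 < b := exp_pos _
  have hs0 : 0 < s := exp_pos _
  set θ := thetaP p with hθ
  set ℓ := log p / (p-1) with hℓ
  set m := mgW (swapW w) 0
  set n := mgW w 0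
  set q := mgW (shearW (-1) w) 0
  set t := a / (a + b) with htd
  have h1t : 1 - t = b / (a + b) := by rw [htd]; field_simp; ring
  rw [add_comm b a, ← h1t] at ht'
  have hmid := mid_case hα hα1 th0 th1 hsol' ht (by linarith)
  have hkey : s ≤ exp ℓ * (a + b) := by
    have h1 : 1/n ≤ a := by rw [div_le_iff₀ hn]; exact bX1
    have h2 : 1/m ≤ b := by rw [div_le_iff₀ hm]; exact bY1
    calc s = s * q * (1/q) := by field_simp
      _ ≤ exp ℓ * (1/n + 1/m) := by gcongr
      _ ≤ _ := by gcongr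
  calc s ^ α ≤ (exp ℓ * (a + b)) ^ α := rpow_le_rpow hs0.le hkey hα.le
    _ = exp (ℓ * α) * (a + b) ^ α := by rw [mul_rpow (exp_pos _).le (by positivity), ← exp_mul]
    _ ≤ (t ^ α + (1 - t) ^ α) * (a + b) ^ α := by gcongr
    _ = a ^ α + b ^ α := by
        rw [h1t, htd, div_rpow ha0.le (by positivity), div_rpow hb0.le (by positivity)]
        have : (a + b) ^ α ≠ 0 := (rpow_pos_of_pos (by positivity) _).ne'
        field_simp

lemma map_wd {T T' : ℝ × ℝ → ℝ × ℝ} (hT : MeasurePreserving T) (hT' : Measurable T') (hinv : ∀ z, T' (T z) = z)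
    {g : ℝ × ℝ → ℝ≥0∞} (hg : Measurable g) :
    Measure.map T (volume.withDensity g) = volume.withDensity (fun z => g (T' z)) := by
  ext s hs
  rw [Measure.map_apply hT.measurable hs, withDensity_apply _ (hT.measurable hs), withDensity_apply _ hs]
  have := hT.setLIntegral_comp_preimage hs (hg.comp hT')
  simpa only [Function.comp_apply, hinv] using this

lemma GoodW.map_fst {w : ℝ × ℝ → ℝ} (h : GoodW w) :
    Measure.map Prod.fst (volume.withDensity (fun z => ENNReal.ofReal (w z)))
      = volume.withDensity (fun x => ENNReal.ofReal (mgW w x)) := by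
  have hm := h.meas
  ext s hs
  rw [Measure.map_apply measurable_fst hs, withDensity_apply _ (measurable_fst hs), withDensity_apply _ hs]
  rw [show (Prod.fst ⁻¹' s : Set (ℝ × ℝ)) = s ×ˢ Set.univ by ext; simp, Measure.volume_eq_prod,
    setLIntegral_prod _ (by fun_prop)]
  apply lintegral_congr
  intro x
  rw [mgW, ofReal_integral_eq_lintegral_ofReal (h.slice_int x) (Filter.Eventually.of_forall fun y => h.lc.1 _)]
  simp

lemma GoodF.density_ae {F f : ℝ → ℝ} (h : GoodF F) (hf : Measurable f) (hf0 : ∀ x, 0 ≤ f x)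
    (he : (volume.withDensity (fun x => ENNReal.ofReal (f x)) : Measure ℝ) = volume.withDensity (fun x => ENNReal.ofReal (F x))) :
    f =ᵐ[volume] F := by
  have hm := h.meas
  have h1 : ∫⁻ x, ENNReal.ofReal (f x) ≠ ∞ := by
    have := congrArg (fun μ : Measure ℝ => μ Set.univ) he
    simp only [withDensity_apply _ MeasurableSet.univ, Measure.restrict_univ] at this
    rw [this, ← ofReal_integral_eq_lintegral_ofReal h.int (Filter.Eventually.of_forall h.lc.1)]
    simp
  have := (withDensity_eq_iff (by fun_prop) (by fun_prop) h1).1 he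
  filter_upwards [this] with x hx
  exact (ENNReal.ofReal_eq_ofReal_iff (hf0 x) (h.lc.1 x)).1 hx

lemma renyi_congr {f g : ℝ → ℝ} (p : ℝ) (h : f =ᵐ[volume] g) : renyiEntropy1 p f = renyiEntropy1 p g := by
  rw [renyiEntropy1, renyiEntropy1]
  congr 2
  apply integral_congr_ae
  filter_upwards [h] with x hx
  rw [hx]

lemma exists_good {Ω : Type*} [MeasurableSpace Ω] (P : Measure Ω) [IsProbabilityMeasure P]
    (W : Ω → ℝ × ℝ) (w : ℝ × ℝ → ℝ)
    (hW : HasDensityFn2 P W w) (hw : IsLogConcaveFn w)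
    (hsymm : Measure.map (fun z : ℝ × ℝ => -z) (Measure.map W P) = Measure.map W P) :
    ∃ v, GoodW v ∧ Measure.map W P = volume.withDensity (fun z => ENNReal.ofReal (v z)) := by
  obtain ⟨hWm, hwm, hw0, hmap⟩ := hW
  have hone : ∫⁻ z, ENNReal.ofReal (w z) = 1 := by
    have := congrArg (fun μ : Measure (ℝ × ℝ) => μ Set.univ) hmap
    simp only [withDensity_apply _ MeasurableSet.univ, Measure.restrict_univ] at this
    rw [← this, Measure.map_apply hWm MeasurableSet.univ]; simp
  have mpn : MeasurePreserving (fun z : ℝ × ℝ => -z) := Measure.measurePreserving_neg volume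
  rw [hmap, map_wd mpn (T' := fun z => -z) measurable_neg (fun z => neg_neg z) (by fun_prop)] at hsymm
  have hae : ∀ᵐ z : ℝ × ℝ, w (-z) = w z := by
    have h1 : ∫⁻ z, ENNReal.ofReal (w (-z)) ≠ ∞ := by
      rw [mpn.lintegral_comp (f := fun z => ENNReal.ofReal (w z)) (by fun_prop), hone]; simp
    have := (withDensity_eq_iff (by fun_prop) (by fun_prop) h1).1 hsymm
    filter_upwards [this] with x hx
    exact (ENNReal.ofReal_eq_ofReal_iff (hw0 _) (hw0 x)).1 hx
  set v : ℝ × ℝ → ℝ := fun z => √(w z * w (-z)) with hv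
  have hvw : v =ᵐ[volume] w := by
    filter_upwards [hae] with z hz
    simp only [hv, hz, sqrt_mul_self (hw0 z)]
  have hvo : (fun z => ENNReal.ofReal (v z)) =ᵐ[volume] fun z => ENNReal.ofReal (w z) := by
    filter_upwards [hvw] with z hz; rw [hz]
  have hvm : Measurable v := by fun_prop
  have hwi : Integrable w := by
    refine ⟨hwm.aestronglyMeasurable, ?_⟩
    rw [hasFiniteIntegral_iff_ofReal (Filter.Eventually.of_forall hw0), hone]; simp
  refine ⟨v, ⟨hvm, ⟨fun z => sqrt_nonneg _, ?_⟩, ?_, ?_, ?_⟩, ?_⟩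
  · intro x y a h0 h1
    have i1 := hw.2 x y a h0 h1
    have i2 := hw.2 (-x) (-y) a h0 h1
    rw [show a • (-x) + (1 - a) • (-y) = -(a • x + (1 - a) • y) by module] at i2
    simp only [hv]
    apply le_sqrt_of_sq_le
    have e : ∀ u b : ℝ, 0 ≤ u → (√u ^ b) ^ 2 = u ^ b := by
      intro u b hu
      rw [← rpow_natCast, ← rpow_mul (sqrt_nonneg _), mul_comm, rpow_mul (sqrt_nonneg _)]
      congr 1
      rw [rpow_natCast, sq_sqrt hu]
    rw [mul_pow, e _ _ (mul_nonneg (hw0 _) (hw0 _)), e _ _ (mul_nonneg (hw0 _) (hw0 _)), mul_rpow (hw0 _) (hw0 _), mul_rpow (hw0 _) (hw0 _)]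
    calc _ = (w x ^ a * w y ^ (1 - a)) * (w (-x) ^ a * w (-y) ^ (1 - a)) := by ring
      _ ≤ _ := mul_le_mul i1 i2 (mul_nonneg (rpow_nonneg (hw0 _) _) (rpow_nonneg (hw0 _) _)) (hw0 _)
  · intro z; simp only [hv, neg_neg, mul_comm]
  · exact hwi.congr hvw.symm
  · rw [integral_congr_ae hvw, integral_eq_lintegral_of_nonneg_ae (Filter.Eventually.of_forall hw0) hwm.aestronglyMeasurable, hone]
    simp
  · rw [hmap]; exact (withDensity_congr_ae hvo).symm

theorem busemann_aux {Ω : Type*} [MeasurableSpace Ω]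
    (P : Measure Ω) [IsProbabilityMeasure P]
    (p : ℝ) (hp : 1 < p)
    (α : ℝ) (hα : 0 < α)
    (hαsol : p ^ (α / (p - 1)) = thetaP p ^ α + (1 - thetaP p) ^ α)
    (W : Ω → ℝ × ℝ) (w : ℝ × ℝ → ℝ)
    (hW : HasDensityFn2 P W w) (hw : IsLogConcaveFn w)
    (hsymm : Measure.map (fun z : ℝ × ℝ => -z) (Measure.map W P) = Measure.map W P)
    (fX fY fS : ℝ → ℝ)
    (hfX : HasDensityFn1 P (fun ω => (W ω).1) fX)
    (hfY : HasDensityFn1 P (fun ω => (W ω).2) fY)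
    (hfS : HasDensityFn1 P (fun ω => (W ω).1 + (W ω).2) fS) :
    Real.exp (α * renyiEntropy1 p fS)
      ≤ Real.exp (α * renyiEntropy1 p fX) + Real.exp (α * renyiEntropy1 p fY) := by
  obtain ⟨v, hv, hmap⟩ := exists_good P W w hW hw hsymm
  have hWm := hW.1
  have hvm := hv.meas
  obtain ⟨_, hX1, hX2, hX3⟩ := hfX
  obtain ⟨_, hY1, hY2, hY3⟩ := hfY
  obtain ⟨_, hS1, hS2, hS3⟩ := hfS
  have eX : fX =ᵐ[volume] mgW v := by
    refine hv.mg.density_ae hX1 hX2 ?_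
    rw [← hX3, ← hv.map_fst, ← hmap, Measure.map_map measurable_fst hWm]
    rfl
  have eY : fY =ᵐ[volume] mgW (swapW v) := by
    refine hv.swap.mg.density_ae hY1 hY2 ?_
    rw [← hY3, ← hv.swap.map_fst]
    have e := map_wd measurePreserving_swapR (T' := fun z => (z.2, z.1)) (by fun_prop) (fun z => rfl) (g := fun z => ENNReal.ofReal (v z)) (by fun_prop)
    change Measure.map _ P = Measure.map Prod.fst (volume.withDensity fun z => ENNReal.ofReal (v (z.2, z.1)))
    rw [← e, ← hmap, Measure.map_map (by fun_prop) hWm, Measure.map_map (by fun_prop) (by fun_prop)]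
    rfl
  have eS : fS =ᵐ[volume] mgW (shearW (-1) v) := by
    refine (hv.shear (-1)).mg.density_ae hS1 hS2 ?_
    rw [← hS3, ← (hv.shear (-1)).map_fst]
    have e := map_wd (measurePreserving_shear 1) (T' := fun z => (z.1 + (-1) * z.2, z.2)) (by fun_prop) (fun z => by simp) (g := fun z => ENNReal.ofReal (v z)) (by fun_prop)
    change Measure.map _ P = Measure.map Prod.fst (volume.withDensity fun z => ENNReal.ofReal (v (z.1 + (-1) * z.2, z.2)))
    rw [← e, ← hmap, Measure.map_map (by fun_prop) hWm, Measure.map_map (by fun_prop) (by fun_prop)]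
    congr 1
    funext ω
    simp
  have := good_main hv hp hα hαsol
  rw [renyi_congr p eX, renyi_congr p eY, renyi_congr p eS]
  simpa only [← exp_mul, mul_comm] using this

/-- Busemann-type theorem for `p`-Rényi entropies of log-concave vectors: fix
`p ∈ (1,∞)` and let `α_p > 0` be the (unique) positive solution of
`p^{α/(p-1)} = θ_p^α + (1-θ_p)^α`.  Then for every symmetric random vector `(X,Y)`
in `ℝ²` with log-concave joint density,
`exp(α_p h_p(X+Y)) ≤ exp(α_p h_p(X)) + exp(α_p h_p(Y))`. -/
theorem busemann_renyi_logconcave {Ω : Type*} [MeasurableSpace Ω]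
    (P : Measure Ω) [IsProbabilityMeasure P]
    (p : ℝ) (hp : 1 < p)
    (α : ℝ) (hα : 0 < α)
    (hαsol : p ^ (α / (p - 1)) = thetaP p ^ α + (1 - thetaP p) ^ α)
    (W : Ω → ℝ × ℝ) (w : ℝ × ℝ → ℝ)
    (hW : HasDensityFn2 P W w) (hw : IsLogConcaveFn w)
    (hsymm : Measure.map (fun z : ℝ × ℝ => -z) (Measure.map W P) = Measure.map W P)
    (fX fY fS : ℝ → ℝ)
    (hfX : HasDensityFn1 P (fun ω => (W ω).1) fX)
    (hfY : HasDensityFn1 P (fun ω => (W ω).2) fY)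
    (hfS : HasDensityFn1 P (fun ω => (W ω).1 + (W ω).2) fS) :
    Real.exp (α * renyiEntropy1 p fS)
      ≤ Real.exp (α * renyiEntropy1 p fX) + Real.exp (α * renyiEntropy1 p fY) := by
  exact busemann_aux P p hp α hα hαsol W w hW hw hsymm fX fY fS hfX hfY hfS
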